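/- arXiv:1703.02172 — 4 statements merged into one kernel-verified Lean document; each statement's English description precedes it below -/
import Mathlib

section
/- For every integer n ≥ 2, the set V_{β_n} of points in [0, 1/(β_n−1)] having no universal β_n-expansion has Hausdorff dimension 1. -/
open MeasureTheory Set Filter

noncomputable section

/-- `a` is a β-expansion of `x`: digits in {0,1}, with `a k` the (k+1)-st digit. -/
def IsBetaExpansion (β x : ℝ) (a : ℕ → ℕ) : Prop :=
  (∀ k, a k ≤ 1) ∧ HasSum (fun k => (a k : ℝ) / β ^ (k + 1)) x

/-- `a` is a universal β-expansion of `x`. -/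
def IsUniversalExpansion (β x : ℝ) (a : ℕ → ℕ) : Prop :=
  IsBetaExpansion β x a ∧
    ∀ m : ℕ, 1 ≤ m → ∀ b : Fin m → Fin 2, ∃ k₀ : ℕ, ∀ i : Fin m, a (k₀ + i) = (b i : ℕ)

/-- The set of points of `[0, 1/(β-1)]` without a universal β-expansion. -/
def univSet (β : ℝ) : Set ℝ :=
  {x ∈ Icc 0 (1 / (β - 1)) | ¬ ∃ a : ℕ → ℕ, IsUniversalExpansion β x a}

/-- `β` is the n-bonacci number: the root in (1,2) of `β^n = β^{n-1} + ⋯ + β + 1`. -/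
def IsNBonacci (n : ℕ) (β : ℝ) : Prop :=
  β ∈ Ioo (1 : ℝ) 2 ∧ β ^ n = ∑ i ∈ Finset.range n, β ^ i


lemma nb_sum_gt {n : ℕ} (hn : 2 ≤ n) {r s : ℝ} (hr : 0 < r) (hrs : r < s)
    (hs : s ^ n ≤ ∑ i ∈ Finset.range n, s ^ i) : r ^ n < ∑ i ∈ Finset.range n, r ^ i := by
  have hs0 : 0 < s := hr.trans hrs
  have h1 : 1 ≤ ∑ i ∈ Finset.range n, s ^ i / s ^ n := by
    rw [← Finset.sum_div, le_div_iff₀ (by positivity)]; simpa using hs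
  have h2 : ∑ i ∈ Finset.range n, s ^ i / s ^ n < ∑ i ∈ Finset.range n, r ^ i / r ^ n := by
    apply Finset.sum_lt_sum_of_nonempty ⟨0, by simp; omega⟩
    intro i hi
    have hi' : i < n := by simpa using hi
    obtain ⟨k, rfl⟩ := Nat.exists_eq_add_of_lt hi'
    have e : ∀ t : ℝ, 0 < t → t ^ i / t ^ (i + k + 1) = 1 / t ^ (k + 1) := by
      intro t ht
      rw [show i + k + 1 = i + (k + 1) by ring, pow_add]; field_simp
    rw [e s hs0, e r hr]
    apply one_div_lt_one_div_of_lt (by positivity)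
    exact pow_lt_pow_left₀ hrs hr.le (by omega)
  have h3 := h1.trans_lt h2
  rw [← Finset.sum_div, lt_div_iff₀ (by positivity)] at h3
  simpa using h3

lemma nb_root {n : ℕ} (hn : 2 ≤ n) {β : ℝ} (hβ : IsNBonacci n β) {z : ℂ}
    (hz : z ^ n = ∑ i ∈ Finset.range n, z ^ i) (hne : z ≠ (β : ℂ)) : ‖z‖ < 1 := by
  obtain ⟨⟨h1, h2⟩, hb⟩ := hβ
  by_contra hcon
  push Not at hcon
  have hr0 : 0 < ‖z‖ := by linarith
  have hle : ‖z‖ ^ n ≤ ∑ i ∈ Finset.range n, ‖z‖ ^ i := by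
    rw [← norm_pow, hz]
    refine (norm_sum_le _ _).trans ?_
    simp
  have hrb : ‖z‖ ≤ β := by
    by_contra h
    push Not at h
    have := nb_sum_gt hn (by linarith) h hle
    linarith
  have hzz : z ^ n * (2 - z) = 1 := by
    have := mul_geom_sum z n
    rw [← hz] at this
    linear_combination -this
  have hnn : ‖z‖ ^ n * ‖2 - z‖ = 1 := by
    rw [← norm_pow, ← norm_mul, hzz]; simp
  have hge : 2 - ‖z‖ ≤ ‖2 - z‖ := by
    have := norm_sub_norm_le (2 : ℂ) z
    simpa using this
  have hg : ‖z‖ ^ n * (2 - ‖z‖) ≤ 1 := by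
    rw [← hnn]; gcongr
  have hre : ∀ {t : ℝ}, ‖z‖ = t → ‖2 - z‖ = 2 - t → z = (t : ℂ) := by
    intro t ht h
    have e1 : z.re ^ 2 + z.im ^ 2 = t ^ 2 := by
      rw [← ht, ← Complex.normSq_eq_norm_sq, Complex.normSq_apply]; ring
    have e2 : (2 - z.re) ^ 2 + z.im ^ 2 = (2 - t) ^ 2 := by
      rw [← h, ← Complex.normSq_eq_norm_sq, Complex.normSq_apply]; simp; ring
    have e3 : z.re = t := by nlinarith
    have e4 : z.im = 0 := by
      have : z.im ^ 2 = 0 := by rw [e3] at e1; linarith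
      exact pow_eq_zero_iff (two_ne_zero) |>.1 this
    apply Complex.ext <;> simp [e3, e4]
  rcases hrb.lt_or_eq with h | h
  · have hgt := nb_sum_gt hn hr0 h hb.le
    have hm := mul_geom_sum ‖z‖ n
    have h1' : ‖z‖ = 1 := by
      rcases hcon.eq_or_lt with h' | h'
      · exact h'.symm
      · exfalso
        have : 0 < (‖z‖ - 1) * (∑ i ∈ Finset.range n, ‖z‖ ^ i - ‖z‖ ^ n) :=
          mul_pos (by linarith) (by linarith)
        nlinarith
    have h2' : ‖2 - z‖ = 2 - 1 := by
      rw [h1'] at hnn; simp at hnn; rw [hnn]; norm_num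
    have := hre h1' h2'
    rw [this] at hz
    simp at hz
    have : n = 1 := by exact_mod_cast hz.symm
    omega
  · have hm := mul_geom_sum β n
    rw [← hb] at hm
    have h3 : β ^ n * (2 - β) = 1 := by linear_combination -hm
    have h4 : ‖2 - z‖ = 2 - β := by
      rw [h] at hnn
      have : (β ^ n) ≠ 0 := by positivity
      apply mul_left_cancel₀ this; rw [hnn, h3]
    exact hne (hre h h4)

open Polynomial in
lemma norm_aeval_le {z : ℂ} (hz : ‖z‖ < 1) (p : ℤ[X]) (hp : ∀ i, |p.coeff i| ≤ 1) :
    ‖aeval z p‖ ≤ (1 - ‖z‖)⁻¹ := by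
  rw [aeval_eq_sum_range]
  refine (norm_sum_le _ _).trans ?_
  have : ∀ i ∈ Finset.range (p.natDegree + 1), ‖p.coeff i • z ^ i‖ ≤ ‖z‖ ^ i := by
    intro i _
    rw [zsmul_eq_mul, norm_mul, norm_pow]
    have : ‖((p.coeff i : ℤ) : ℂ)‖ ≤ 1 := by
      rw [Complex.norm_intCast]; exact_mod_cast hp i
    nlinarith [pow_nonneg (norm_nonneg z) i]
  refine (Finset.sum_le_sum this).trans ?_
  rw [← tsum_geometric_of_lt_one (norm_nonneg z) hz]
  exact (summable_geometric_of_lt_one (norm_nonneg z) hz).sum_le_tsum _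
    (fun i _ => by positivity)

open Polynomial in
lemma nb_finite {n : ℕ} (hn : 2 ≤ n) {β : ℝ} (hβ : IsNBonacci n β) (K : ℝ) :
    {s : ℝ | |s| ≤ K ∧ ∃ p : ℤ[X], (∀ i, |p.coeff i| ≤ 1) ∧ aeval β p = s}.Finite := by
  have hInt : IsIntegral ℤ β := by
    refine ⟨X ^ n - ∑ i ∈ Finset.range n, X ^ i, ?_, ?_⟩
    · apply monic_X_pow_sub
      refine (degree_sum_le _ _).trans_lt ?_
      rw [Finset.sup_lt_iff (by simp)]
      intro i hi
      rw [degree_X_pow]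
      exact_mod_cast Finset.mem_range.1 hi
    · simp [eval₂_finsetSum, hβ.2]
  have hIntQ : IsIntegral ℚ β := hInt.tower_top
  let L := IntermediateField.adjoin ℚ {β}
  have : FiniteDimensional ℚ L := IntermediateField.adjoin.finiteDimensional hIntQ
  have : NumberField L := ⟨⟩
  let b : L := IntermediateField.AdjoinSimple.gen ℚ β
  have hbβ : algebraMap L ℝ b = β := IntermediateField.AdjoinSimple.algebraMap_gen ℚ β
  have hinj : Function.Injective (algebraMap L ℝ) := (algebraMap L ℝ).injective
  have hbL : b ^ n = ∑ i ∈ Finset.range n, b ^ i := by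
    apply hinj
    rw [map_pow, map_sum, hbβ, hβ.2]
    simp only [map_pow, hbβ]
  have hbi : IsIntegral ℤ b := by
    rw [← isIntegral_algebraMap_iff hinj, hbβ]; exact hInt
  obtain ⟨B, hB⟩ : ∃ B : ℝ, ∀ φ : L →+* ℂ, (1 - ‖φ b‖)⁻¹ ≤ B := by
    obtain ⟨B, hB⟩ := (Set.finite_range (fun φ : L →+* ℂ => (1 - ‖φ b‖)⁻¹)).bddAbove
    exact ⟨B, fun φ => hB ⟨φ, rfl⟩⟩
  have hfin := NumberField.Embeddings.finite_of_norm_le L ℂ (max B K)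
  refine (hfin.image (algebraMap L ℝ)).subset ?_
  rintro s ⟨hs, p, hp, rfl⟩
  refine ⟨aeval b p, ⟨?_, ?_⟩, ?_⟩
  · exact IsIntegral.of_mem_of_fg _ (hbi.fg_adjoin_singleton) _ (aeval_mem_adjoin_singleton ℤ b)
  · intro φ
    have e : φ (aeval b p) = aeval (φ b) p := by
      have := (aeval_algHom_apply (φ.toIntAlgHom) b p).symm
      simpa using this
    rw [e]
    have hroot : (φ b) ^ n = ∑ i ∈ Finset.range n, (φ b) ^ i := by
      rw [← map_pow, hbL, map_sum]; simp
    by_cases h : φ b = (β : ℂ)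
    · rw [h]
      have : aeval (β : ℂ) p = ((aeval β p : ℝ) : ℂ) := by
        have := aeval_algebraMap_apply ℂ β p
        simpa using this
      rw [this, Complex.norm_real, Real.norm_eq_abs]
      exact hs.trans (le_max_right _ _)
    · exact (norm_aeval_le (nb_root hn hβ hroot h) p hp).trans ((hB φ).trans (le_max_left _ _))
  · rw [← aeval_algebraMap_apply, hbβ]

/-- value of the digit sequence `d` in base `B` -/
def bsum (B : ℝ) (d : ℕ → ℝ) : ℝ := ∑' i, d i / B ^ (i + 1)

/-- integer part after `k` shifts -/
def bpart (B : ℝ) (d : ℕ → ℝ) : ℕ → ℝ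
  | 0 => 0
  | k + 1 => B * bpart B d k + d k

lemma hasSum_geo {B : ℝ} (hB : 1 < B) (M : ℝ) :
    HasSum (fun i : ℕ => M / B ^ (i + 1)) (M / (B - 1)) := by
  have h := (hasSum_geometric_of_lt_one (r := B⁻¹) (by positivity)
    (inv_lt_one_of_one_lt₀ hB)).mul_left (M / B)
  have e1 : (fun i : ℕ => M / B ^ (i + 1)) = fun i => M / B * B⁻¹ ^ i := by
    ext i; rw [inv_pow, pow_succ]; field_simp
  have e2 : M / (B - 1) = M / B * (1 - B⁻¹)⁻¹ := by
    have : B - 1 ≠ 0 := by linarith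
    have : B ≠ 0 := by linarith
    have : 1 - B⁻¹ ≠ 0 := by
      have := inv_lt_one_of_one_lt₀ hB
      linarith
    field_simp
  rw [e1, e2]; exact h

lemma bsum_summable {B M : ℝ} (hB : 1 < B) {d : ℕ → ℝ} (hd : ∀ i, 0 ≤ d i ∧ d i ≤ M) :
    Summable (fun i => d i / B ^ (i + 1)) := by
  have hB0 : 0 < B := by linarith
  refine Summable.of_nonneg_of_le (fun i => ?_) (fun i => ?_) (hasSum_geo hB M).summable
  · have := (hd i).1; positivity
  · have := (hd i).2; gcongr

lemma bsum_nonneg {B M : ℝ} (hB : 1 < B) {d : ℕ → ℝ} (hd : ∀ i, 0 ≤ d i ∧ d i ≤ M) :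
    0 ≤ bsum B d := by
  have hB0 : 0 < B := by linarith
  exact tsum_nonneg fun i => by have := (hd i).1; positivity

lemma bsum_le {B M : ℝ} (hB : 1 < B) {d : ℕ → ℝ} (hd : ∀ i, 0 ≤ d i ∧ d i ≤ M) :
    bsum B d ≤ M / (B - 1) := by
  have hB0 : 0 < B := by linarith
  rw [← (hasSum_geo hB M).tsum_eq]
  refine (bsum_summable hB hd).tsum_le_tsum (fun i => ?_) (hasSum_geo hB M).summable
  have := (hd i).2; gcongr

lemma bsum_step {B M : ℝ} (hB : 1 < B) {d : ℕ → ℝ} (hd : ∀ i, 0 ≤ d i ∧ d i ≤ M) :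
    B * bsum B d = d 0 + bsum B (fun j => d (j + 1)) := by
  have hB0 : B ≠ 0 := by linarith
  have hs := bsum_summable hB hd
  unfold bsum
  rw [hs.tsum_eq_zero_add, mul_add, ← tsum_mul_left]
  congr 1
  · field_simp; ring
  · congr 1; ext i; rw [pow_succ B (i + 1)]; field_simp

lemma bsum_part {B M : ℝ} (hB : 1 < B) {d : ℕ → ℝ} (hd : ∀ i, 0 ≤ d i ∧ d i ≤ M) (k : ℕ) :
    B ^ k * bsum B d = bpart B d k + bsum B (fun j => d (k + j)) := by
  induction k with
  | zero => simp [bpart]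
  | succ k ih =>
    have h := bsum_step hB (d := fun j => d (k + j)) (fun i => hd _)
    rw [pow_succ', mul_assoc, ih, bpart, mul_add, h]
    simp only [add_zero, add_assoc, add_comm 1]

lemma bpart_zero {B : ℝ} {d : ℕ → ℝ} (k : ℕ) (h : ∀ j < k, d j = 0) : bpart B d k = 0 := by
  induction k with
  | zero => rfl
  | succ k ih => rw [bpart, ih (fun j hj => h j (by omega)), h k (by omega)]; simp

open Polynomial in
/-- `s` is a 0-1 polynomial of degree `< k` evaluated at `β` -/
def IsVal (β : ℝ) (k : ℕ) (s : ℝ) : Prop :=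
  ∃ p : ℤ[X], (∀ i, 0 ≤ p.coeff i ∧ p.coeff i ≤ 1) ∧ (∀ i, k ≤ i → p.coeff i = 0) ∧ aeval β p = s

lemma IsVal.zero (β : ℝ) (k : ℕ) : IsVal β k 0 := ⟨0, by simp, by simp, by simp⟩

lemma IsVal.one (β : ℝ) : IsVal β 1 1 := by
  refine ⟨1, fun i => ?_, fun i hi => ?_, by simp⟩
  · rw [Polynomial.coeff_one]; split_ifs <;> simp
  · rw [Polynomial.coeff_one]; split_ifs with h
    · omega
    · rfl

lemma IsVal.mul_add {β : ℝ} {k m : ℕ} {s v : ℝ} (hs : IsVal β k s) (hv : IsVal β m v) :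
    IsVal β (k + m) (β ^ m * s + v) := by
  obtain ⟨p, p1, p2, rfl⟩ := hs
  obtain ⟨q, q1, q2, rfl⟩ := hv
  refine ⟨Polynomial.X ^ m * p + q, fun i => ?_, fun i hi => ?_, by simp⟩
  · rw [Polynomial.coeff_add, Polynomial.coeff_X_pow_mul']
    split_ifs with h
    · rw [q2 i h, add_zero]; exact p1 _
    · rw [zero_add]; exact q1 _
  · rw [Polynomial.coeff_add, Polynomial.coeff_X_pow_mul', if_pos (by omega), p2 _ (by omega),
      q2 _ (by omega), add_zero]

lemma IsVal.sum (β : ℝ) (m : ℕ) : IsVal β m (∑ i ∈ Finset.range m, β ^ i) := by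
  induction m with
  | zero => simpa using IsVal.zero β 0
  | succ m ih =>
    rw [Finset.sum_range_succ]
    have := (IsVal.one β).mul_add ih
    rwa [add_comm 1 m, mul_one, add_comm (β ^ m)] at this

lemma IsVal.dense {β : ℝ} (h1 : 1 < β) (h2 : β < 2) (m : ℕ) (y : ℝ) (hy : 0 ≤ y)
    (hy' : y ≤ ∑ i ∈ Finset.range m, β ^ i) : ∃ s, IsVal β m s ∧ s ≤ y ∧ y ≤ s + 1 := by
  induction m generalizing y with
  | zero =>
    refine ⟨0, IsVal.zero β 0, hy, ?_⟩
    simp at hy'; linarith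
  | succ m ih =>
    have up : ∀ s, IsVal β m s → IsVal β (m + 1) s := by
      intro s hs
      have := (IsVal.zero β 1).mul_add hs
      rwa [add_comm 1 m, mul_zero, zero_add] at this
    rw [Finset.sum_range_succ] at hy'
    by_cases hc : y ≤ ∑ i ∈ Finset.range m, β ^ i
    · obtain ⟨s, a, b, c⟩ := ih y hy hc
      exact ⟨s, up s a, b, c⟩
    · push Not at hc
      by_cases hc2 : β ^ m ≤ y
      · obtain ⟨s, a, b, c⟩ := ih (y - β ^ m) (by linarith) (by linarith)
        refine ⟨β ^ m + s, ?_, by linarith, by linarith⟩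
        have := (IsVal.one β).mul_add a
        rwa [add_comm 1 m, mul_one] at this
      · push Not at hc2
        refine ⟨_, up _ (IsVal.sum β m), hc.le, ?_⟩
        have hm := mul_geom_sum β m
        have : 0 ≤ ∑ i ∈ Finset.range m, β ^ i := Finset.sum_nonneg fun i _ => by positivity
        nlinarith

lemma isVal_bpart {β : ℝ} {m : ℕ} {d : ℕ → ℝ} (hd : ∀ i, IsVal β m (d i)) (k : ℕ) :
    IsVal β (m * k) (bpart (β ^ m) d k) := by
  induction k with
  | zero => exact IsVal.zero β _
  | succ k ih => rw [mul_add, mul_one, bpart]; exact ih.mul_add (hd k)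

lemma isVal_sub {β : ℝ} {k l : ℕ} {s t : ℝ} (hs : IsVal β k s) (ht : IsVal β l t) :
    ∃ p : Polynomial ℤ, (∀ i, |p.coeff i| ≤ 1) ∧ Polynomial.aeval β p = s - t := by
  obtain ⟨p, p1, p2, rfl⟩ := hs
  obtain ⟨q, q1, q2, rfl⟩ := ht
  refine ⟨p - q, fun i => ?_, by simp⟩
  rw [Polynomial.coeff_sub, abs_le]
  have := p1 i; have := q1 i
  constructor <;> omega

/-- points whose base `B` digits lie in `S` -/
def digitSet (B : ℝ) (S : Finset ℝ) : Set ℝ := {x | ∃ d : ℕ → ℝ, (∀ i, d i ∈ S) ∧ bsum B d = x}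

lemma bsum_sep {B : ℝ} (hB : 1 < B) {S : Finset ℝ} (hS : ∀ v ∈ S, 0 ≤ v ∧ v ≤ B - 1)
    (hsep : ∀ v ∈ S, ∀ w ∈ S, v < w → v + 2 ≤ w) (i : ℕ) (d e : ℕ → ℝ)
    (hd : ∀ i, d i ∈ S) (he : ∀ i, e i ∈ S)
    (hlt : ∀ j < i, d j = e j) (hi : d i ≠ e i) : (B ^ (i + 1))⁻¹ ≤ |bsum B d - bsum B e| := by
  have hB0 : 0 < B := by linarith
  have base : ∀ d e : ℕ → ℝ, (∀ i, d i ∈ S) → (∀ i, e i ∈ S) → d 0 < e 0 →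
      B⁻¹ ≤ |bsum B d - bsum B e| := by
    intro d e hd he h
    have s1 := bsum_step hB (fun i => hS _ (hd i))
    have s2 := bsum_step hB (fun i => hS _ (he i))
    have t1 := bsum_nonneg hB (d := fun j => e (j + 1)) (fun i => hS _ (he _))
    have t2 := bsum_le hB (d := fun j => d (j + 1)) (fun i => hS _ (hd _))
    rw [div_self (by linarith)] at t2
    have := hsep _ (hd 0) _ (he 0) h
    have h3 : 1 ≤ B * (bsum B e - bsum B d) := by linarith
    rw [abs_sub_comm]
    refine le_trans ?_ (le_abs_self _)
    rw [inv_le_iff_one_le_mul₀ hB0, mul_comm]; exact h3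
  induction i generalizing d e with
  | zero =>
    rw [zero_add, pow_one]
    rcases lt_or_gt_of_ne hi with h | h
    · exact base d e hd he h
    · rw [abs_sub_comm]; exact base e d he hd h
  | succ i ih =>
    have := ih (fun j => d (j + 1)) (fun j => e (j + 1)) (fun j => hd _) (fun j => he _)
      (fun j hj => hlt _ (by omega)) hi
    have s1 := bsum_step hB (fun i => hS _ (hd i))
    have s2 := bsum_step hB (fun i => hS _ (he i))
    have h0 := hlt 0 (by omega)
    have e1 : bsum B (fun j => d (j + 1)) - bsum B (fun j => e (j + 1))
        = B * (bsum B d - bsum B e) := by linarith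
    rw [e1, abs_mul, abs_of_pos hB0] at this
    rw [pow_succ, mul_inv, ← div_eq_mul_inv, div_le_iff₀ hB0, mul_comm _ B]
    exact this

open scoped NNReal ENNReal in
lemma le_dimH_digitSet {B : ℝ} (hB : 1 < B) {S : Finset ℝ} (hS : ∀ v ∈ S, 0 ≤ v ∧ v ≤ B - 1)
    (hsep : ∀ v ∈ S, ∀ w ∈ S, v < w → v + 2 ≤ w) (hcard : 1 < S.card) {r : ℝ≥0} (hr : 0 < r)
    (hrS : B ^ (r : ℝ) ≤ S.card) : (r : ℝ≥0∞) ≤ dimH (digitSet B S) := by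
  have hB0 : 0 < B := by linarith
  let v : Fin S.card ≃ S := S.equivFin.symm
  let G : (ℕ → Fin S.card) → ℝ := fun c => bsum B (fun i => (v (c i) : ℝ))
  have key : ∀ c c' : ℕ → Fin S.card, c ≠ c' →
      |Real.ofDigits c - Real.ofDigits c'| ≤ B ^ (r : ℝ) * |G c - G c'| ^ (r : ℝ) ∧ G c ≠ G c' := by
    intro c c' hne
    have hex : ∃ i, c i ≠ c' i := Function.ne_iff.1 hne
    classical
    let i := Nat.find hex
    have hi : c i ≠ c' i := Nat.find_spec hex
    have hlt : ∀ j < i, c j = c' j := fun j hj => not_not.1 (Nat.find_min hex hj)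
    have h1 := Real.abs_ofDigits_sub_ofDigits_le hlt
    have h2 : (B ^ (i + 1))⁻¹ ≤ |G c - G c'| := bsum_sep hB hS hsep i _ _ (fun j => (v (c j)).2)
      (fun j => (v (c' j)).2) (fun j hj => by rw [hlt j hj])
      (fun h => hi (v.injective (Subtype.ext h)))
    have hpos : 0 < (B ^ (i + 1))⁻¹ := by positivity
    constructor
    · refine h1.trans ?_
      calc ((S.card : ℝ) ^ i)⁻¹ ≤ ((B ^ (r : ℝ)) ^ i)⁻¹ := by gcongr
        _ = B ^ (r : ℝ) * ((B ^ (i + 1))⁻¹) ^ (r : ℝ) := by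
          rw [Real.inv_rpow (by positivity), ← Real.rpow_natCast B (i + 1), ← Real.rpow_mul hB0.le,
            mul_comm _ (r : ℝ), Real.rpow_mul hB0.le, Real.rpow_natCast, pow_succ]
          have : 0 < B ^ (r : ℝ) := by positivity
          field_simp
        _ ≤ _ := by gcongr
    · intro h
      rw [h, sub_self, abs_zero] at h2
      linarith
  have Ginj : Function.Injective G := by
    intro c c' h
    by_contra hne
    exact (key c c' hne).2 h
  have hmem : ∀ x ∈ digitSet B S, ∃ c, G c = x := by
    rintro x ⟨d, hd, rfl⟩
    exact ⟨fun i => v.symm ⟨d i, hd i⟩, by simp [G]⟩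
  have : Nonempty (ℕ → Fin S.card) := ⟨fun _ => ⟨0, by omega⟩⟩
  let f : ℝ → ℝ := fun x => Real.ofDigits (Function.invFun G x)
  have hf : ∀ c, f (G c) = Real.ofDigits c := by
    intro c; simp only [f]; rw [Function.leftInverse_invFun Ginj c]
  have hH : HolderOnWith (B ^ (r : ℝ)).toNNReal r f (digitSet B S) := by
    intro x hx y hy
    obtain ⟨c, rfl⟩ := hmem x hx
    obtain ⟨c', rfl⟩ := hmem y hy
    rw [hf, hf]
    by_cases h : c = c'
    · subst h; simp
    · have := (key c c' h).1
      change _ ≤ ENNReal.ofReal (B ^ (r : ℝ)) * _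
      rw [edist_dist, edist_dist, Real.dist_eq, Real.dist_eq,
        ENNReal.ofReal_rpow_of_nonneg (abs_nonneg _) r.coe_nonneg,
        ← ENNReal.ofReal_mul (by positivity)]
      exact ENNReal.ofReal_le_ofReal this
  have h1 := hH.dimH_image_le hr
  have h2 : Icc (0 : ℝ) 1 ⊆ f '' (digitSet B S) := by
    intro y hy
    obtain ⟨c, -, rfl⟩ := Real.ofDigits_SurjOn hcard hy
    exact ⟨G c, ⟨_, fun i => (v (c i)).2, rfl⟩, hf c⟩
  have h3 : dimH (Icc (0 : ℝ) 1) = 1 := by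
    rw [Real.dimH_of_nonempty_interior (by simp)]; simp
  have h4 : (1 : ℝ≥0∞) ≤ dimH (digitSet B S) / r := h3 ▸ (dimH_mono h2).trans h1
  rw [ENNReal.le_div_iff_mul_le (by simp [hr.ne']) (by simp), one_mul] at h4
  exact h4

lemma card_near (T : Finset ℕ) (z K : ℝ) (hT : ∀ q ∈ T, |3 * (q : ℝ) + z| ≤ K + 1) :
    T.card ≤ ⌈K + 1⌉₊ + 1 := by
  rcases T.eq_empty_or_nonempty with rfl | hne
  · simp
  have hsub : T ⊆ Finset.Icc (T.min' hne) (T.min' hne + ⌈K + 1⌉₊) := by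
    intro q hq
    rw [Finset.mem_Icc]
    refine ⟨T.min'_le q hq, ?_⟩
    have h1 := abs_le.1 (hT q hq)
    have h2 := abs_le.1 (hT _ (T.min'_mem hne))
    have h3 := Nat.le_ceil (K + 1)
    have : (q : ℝ) ≤ (T.min' hne : ℝ) + ⌈K + 1⌉₊ := by linarith
    exact_mod_cast this
  refine (Finset.card_le_card hsub).trans ?_
  simp; omega

lemma exists_exponent {β r : ℝ} (h1 : 1 < β) (hr1 : r < 1) (C : ℝ) :
    ∃ m : ℕ, 1 ≤ m ∧ (β ^ m) ^ r ≤ β ^ m / 3 - C := by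
  have hl : Tendsto (fun m : ℕ => β ^ m) atTop atTop := tendsto_pow_atTop_atTop_of_one_lt h1
  have hl2 : Tendsto (fun m : ℕ => (β ^ m) ^ (1 - r)) atTop atTop :=
    (tendsto_rpow_atTop (by linarith)).comp hl
  obtain ⟨m, hm1, hm2, hm3⟩ := ((eventually_ge_atTop 1).and
    ((hl.eventually_ge_atTop (6 * C)).and (hl2.eventually_ge_atTop 6))).exists
  refine ⟨m, hm1, ?_⟩
  have hp : 0 < β ^ m := by positivity
  have e : β ^ m = (β ^ m) ^ r * (β ^ m) ^ (1 - r) := by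
    rw [← Real.rpow_add hp]; simp
  have : 0 < (β ^ m) ^ r := by positivity
  nlinarith

lemma exists_digits {β r K : ℝ} (h1 : 1 < β) (h2 : β < 2) (hr : 0 < r) (hr1 : r < 1)
    (F : Finset ℝ) : ∃ m : ℕ, 1 ≤ m ∧ ∃ S : Finset ℝ,
      (∀ v ∈ S, IsVal β m v) ∧ (∀ v ∈ S, 0 ≤ v ∧ v ≤ β ^ m - 1) ∧
      (∀ v ∈ S, ∀ w ∈ S, v < w → v + 2 ≤ w) ∧ (∀ v ∈ S, ∀ s ∈ F, K < |v + β ^ m * s|) ∧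
      1 < S.card ∧ (β ^ m) ^ r ≤ S.card := by
  classical
  obtain ⟨m, hm, hmr⟩ := exists_exponent h1 hr1 (2 + F.card * ((⌈K + 1⌉₊ + 1 : ℕ) : ℝ))
  refine ⟨m, hm, ?_⟩
  have hp : 0 < β ^ m := by positivity
  have hp1 : 1 < β ^ m := one_lt_pow₀ h1 (by omega)
  let Q := ⌊β ^ m / 3⌋₊ - 1
  have hQ : ∀ q : ℕ, q < Q → 3 * (q : ℝ) + 1 ≤ β ^ m - 1 := by
    intro q hq
    have a : q + 2 ≤ ⌊β ^ m / 3⌋₊ := by omega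
    have b : ((q + 2 : ℕ) : ℝ) ≤ β ^ m / 3 :=
      (Nat.cast_le.2 a).trans (Nat.floor_le (by positivity))
    push_cast at b
    linarith
  have hQ' : β ^ m / 3 - 2 ≤ Q := by
    have a := Nat.lt_floor_add_one (β ^ m / 3)
    have b : ⌊β ^ m / 3⌋₊ ≤ Q + 1 := by omega
    have c : ((⌊β ^ m / 3⌋₊ : ℕ) : ℝ) ≤ Q + 1 := by exact_mod_cast b
    linarith
  have hex : ∀ q : ℕ, ∃ s, q < Q → IsVal β m s ∧ s ≤ 3 * (q : ℝ) + 1 ∧ 3 * (q : ℝ) + 1 ≤ s + 1 := by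
    intro q
    by_cases hq : q < Q
    · have hm' := mul_geom_sum β m
      have h0 : 0 ≤ ∑ i ∈ Finset.range m, β ^ i := Finset.sum_nonneg fun i _ => by positivity
      obtain ⟨s, hs⟩ := IsVal.dense h1 h2 m (3 * (q : ℝ) + 1) (by positivity)
        ((hQ q hq).trans (by nlinarith))
      exact ⟨s, fun _ => hs⟩
    · exact ⟨0, fun h => absurd h hq⟩
  choose p hpp using hex
  have hlt : ∀ q q', q < Q → q' < Q → q < q' → p q + 2 ≤ p q' := by
    intro q q' hq hq' h
    have a := (hpp q hq).2.1
    have b := (hpp q' hq').2.2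
    have c : (q : ℝ) + 1 ≤ q' := by exact_mod_cast h
    linarith
  let good := (Finset.range Q).filter (fun q => ∀ s ∈ F, K < |p q + β ^ m * s|)
  let bad : ℝ → Finset ℕ := fun s => (Finset.range Q).filter (fun q => |p q + β ^ m * s| ≤ K)
  have hbad : ∀ s ∈ F, (bad s).card ≤ ⌈K + 1⌉₊ + 1 := by
    intro s _
    apply card_near _ (β ^ m * s)
    intro q hq
    simp only [bad, Finset.mem_filter, Finset.mem_range] at hq
    have a := (hpp q hq.1).2
    have b := abs_le.1 hq.2
    rw [abs_le]
    constructor <;> linarith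
  have hcov : Finset.range Q ⊆ good ∪ F.biUnion bad := by
    intro q hq
    by_cases h : ∀ s ∈ F, K < |p q + β ^ m * s|
    · exact Finset.mem_union_left _ (Finset.mem_filter.2 ⟨hq, h⟩)
    · push Not at h
      obtain ⟨s, hs, hs'⟩ := h
      exact Finset.mem_union_right _ (Finset.mem_biUnion.2 ⟨s, hs, Finset.mem_filter.2 ⟨hq, hs'⟩⟩)
  have hc : Q ≤ good.card + F.card * (⌈K + 1⌉₊ + 1) := by
    have a := Finset.card_le_card hcov
    rw [Finset.card_range] at a
    refine a.trans ((Finset.card_union_le _ _).trans ?_)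
    gcongr
    exact Finset.card_biUnion_le_card_mul _ _ _ hbad
  have hmemg : ∀ q ∈ good, q < Q ∧ ∀ s ∈ F, K < |p q + β ^ m * s| := by
    intro q hq
    simpa [good] using hq
  have hcard : (good.image p).card = good.card := by
    apply Finset.card_image_of_injOn
    intro q hq q' hq' h
    have hq1 := (hmemg q hq).1
    have hq2 := (hmemg q' hq').1
    by_contra hne
    rcases lt_or_gt_of_ne hne with h' | h'
    · have := hlt q q' hq1 hq2 h'; linarith
    · have := hlt q' q hq2 hq1 h'; linarith
  have hfin : (β ^ m) ^ r ≤ ((good.image p).card : ℝ) := by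
    rw [hcard]
    have : (Q : ℝ) ≤ good.card + F.card * ((⌈K + 1⌉₊ + 1 : ℕ) : ℝ) := by exact_mod_cast hc
    linarith
  refine ⟨good.image p, ?_, ?_, ?_, ?_, ?_, hfin⟩
  · intro v hv
    obtain ⟨q, hq, rfl⟩ := Finset.mem_image.1 hv
    exact (hpp q (hmemg q hq).1).1
  · intro v hv
    obtain ⟨q, hq, rfl⟩ := Finset.mem_image.1 hv
    have a := (hpp q (hmemg q hq).1).2
    have b := hQ q (hmemg q hq).1
    have c : (0 : ℝ) ≤ q := by positivity
    constructor <;> linarith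
  · intro v hv w hw h
    obtain ⟨q, hq, rfl⟩ := Finset.mem_image.1 hv
    obtain ⟨q', hq', rfl⟩ := Finset.mem_image.1 hw
    have hq1 := (hmemg q hq).1
    have hq2 := (hmemg q' hq').1
    rcases lt_trichotomy q q' with h' | h' | h'
    · exact hlt q q' hq1 hq2 h'
    · subst h'; exact absurd h (lt_irrefl _)
    · have := hlt q' q hq2 hq1 h'; linarith
  · intro v hv
    obtain ⟨q, hq, rfl⟩ := Finset.mem_image.1 hv
    exact (hmemg q hq).2
  · have := (Real.one_lt_rpow hp1 hr).trans_le hfin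
    exact_mod_cast this

lemma digitSet_subset {β : ℝ} (h1 : 1 < β) (h2 : β < 2) {m : ℕ} (hm : 1 ≤ m) {S : Finset ℝ}
    {F : Finset ℝ}
    (hF : ∀ s : ℝ, |s| ≤ 1 / (β - 1) + 1 →
      (∃ p : Polynomial ℤ, (∀ i, |p.coeff i| ≤ 1) ∧ Polynomial.aeval β p = s) → s ∈ F)
    (hV : ∀ v ∈ S, IsVal β m v) (hS : ∀ v ∈ S, 0 ≤ v ∧ v ≤ β ^ m - 1)
    (hfar : ∀ v ∈ S, ∀ s ∈ F, 1 / (β - 1) + 1 < |v + β ^ m * s|) :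
    digitSet (β ^ m) S ⊆ univSet β := by
  rintro x ⟨d, hd, rfl⟩
  have hB1 : 1 < β ^ m := one_lt_pow₀ h1 (by omega)
  have hdb : ∀ i, 0 ≤ d i ∧ d i ≤ β ^ m - 1 := fun i => hS _ (hd i)
  have hT : ∀ i, 0 ≤ bsum (β ^ m) (fun j => d (i + j)) ∧ bsum (β ^ m) (fun j => d (i + j)) ≤ 1 := by
    intro i
    have a := bsum_nonneg hB1 (d := fun j => d (i + j)) (fun j => hdb _)
    have b := bsum_le hB1 (d := fun j => d (i + j)) (fun j => hdb _)
    rw [div_self (by linarith)] at b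
    exact ⟨a, b⟩
  have hb1 : 1 ≤ 1 / (β - 1) := by rw [le_div_iff₀ (by linarith)]; linarith
  refine ⟨?_, ?_⟩
  · have := hT 0
    simp only [zero_add] at this
    exact ⟨this.1, this.2.trans hb1⟩
  rintro ⟨b, ⟨hb01, hsum⟩, huniv⟩
  obtain ⟨k₀, hk₀⟩ := huniv (2 * m) (by omega) (fun _ => 0)
  obtain ⟨i, hi1, hi2⟩ : ∃ i, k₀ ≤ m * i ∧ m * i + m ≤ k₀ + 2 * m := by
    refine ⟨(k₀ + m - 1) / m, ?_, ?_⟩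
    · have := Nat.div_add_mod (k₀ + m - 1) m
      have := Nat.mod_lt (k₀ + m - 1) (show 0 < m by omega)
      omega
    · have := Nat.div_add_mod (k₀ + m - 1) m
      omega
  let e : ℕ → ℝ := fun j => (b j : ℝ)
  have he : ∀ j, 0 ≤ e j ∧ e j ≤ 1 := fun j => ⟨by simp [e], by simp only [e]; exact_mod_cast hb01 j⟩
  have hx : bsum β e = bsum (β ^ m) d := hsum.tsum_eq
  have hzero : ∀ j < m, e (m * i + j) = 0 := by
    intro j hj
    have := hk₀ ⟨m * i + j - k₀, by omega⟩
    simp only at this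
    rw [show k₀ + (m * i + j - k₀) = m * i + j by omega] at this
    simp only [e, this]; simp
  let y := bsum β (fun j => e (m * i + j))
  have hy0 : 0 ≤ y := bsum_nonneg h1 (fun j => he _)
  have hy1 : β ^ m * y ≤ 1 / (β - 1) := by
    simp only [y]
    rw [bsum_part h1 (d := fun j => e (m * i + j)) (fun j => he _) m, bpart_zero m hzero, zero_add]
    exact bsum_le h1 (fun j => he _)
  have hy2 : y ≤ 1 / (β - 1) := bsum_le h1 (fun j => he _)
  have p1 := bsum_part h1 he (m * i)
  have p2 := bsum_part hB1 hdb i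
  rw [← pow_mul, ← hx, p1] at p2
  have v1 : IsVal β (m * i) (bpart (β ^ m) d i) := isVal_bpart (fun j => hV _ (hd j)) i
  have v2 : IsVal β (1 * (m * i)) (bpart (β ^ 1) e (m * i)) := by
    apply isVal_bpart
    intro j
    have hj := hb01 j
    have : b j = 0 ∨ b j = 1 := by omega
    rcases this with h | h
    · simp only [e, h]; simpa using IsVal.zero β 1
    · simp only [e, h]; simpa using IsVal.one β
  rw [pow_one] at v2
  have hsF := hF (bpart (β ^ m) d i - bpart β e (m * i)) (by
    have := hT i
    rw [abs_le]
    constructor <;> linarith) (isVal_sub v1 v2)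
  have hstep := bsum_step hB1 (d := fun j => d (i + j)) (fun j => hdb _)
  have hT1 := hT (i + 1)
  have e1 : (fun j => d (i + (j + 1))) = fun j => d (i + 1 + j) := by
    ext j; congr 1; omega
  simp only [e1, add_zero] at hstep
  have hfin := hfar _ (hd i) _ hsF
  have e2 : d i + β ^ m * (bpart (β ^ m) d i - bpart β e (m * i))
      = β ^ m * y - bsum (β ^ m) (fun j => d (i + 1 + j)) := by
    have : bpart (β ^ m) d i - bpart β e (m * i) = y - bsum (β ^ m) (fun j => d (i + j)) := by
      linarith
    rw [this, mul_sub, hstep]; ring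
  rw [e2] at hfin
  have hyy : 0 ≤ β ^ m * y := by positivity
  have : |β ^ m * y - bsum (β ^ m) (fun j => d (i + 1 + j))| ≤ 1 / (β - 1) + 1 := by
    rw [abs_le]
    constructor <;> linarith
  linarith

/-- For every integer `n ≥ 2`, the set `V_{β_n}` of points in
`[0, 1/(β_n - 1)]` having no universal `β_n`-expansion has Hausdorff dimension 1. -/
theorem dimH_univSet_nbonacci (n : ℕ) (hn : 2 ≤ n) (β : ℝ) (hβ : IsNBonacci n β) :
    dimH (univSet β) = 1 := by
  have h1 := hβ.1.1
  have h2 := hβ.1.2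
  apply le_antisymm
  · exact (dimH_mono (subset_univ _)).trans_eq Real.dimH_univ
  have main : ∀ r : NNReal, 0 < r → r < 1 → (r : ENNReal) ≤ dimH (univSet β) := by
    intro r hr hr1
    have hfin := nb_finite hn hβ (1 / (β - 1) + 1)
    obtain ⟨m, hm, S, a, b, c, d, e, f⟩ := exists_digits (K := 1 / (β - 1) + 1) h1 h2
      (r := (r : ℝ)) (by exact_mod_cast hr) (by exact_mod_cast hr1) hfin.toFinset
    refine (le_dimH_digitSet (one_lt_pow₀ h1 (by omega)) b c e hr f).trans (dimH_mono ?_)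
    refine digitSet_subset h1 h2 hm (F := hfin.toFinset) ?_ a b d
    intro s hs hp
    rw [Set.Finite.mem_toFinset]
    exact ⟨hs, hp⟩
  refine le_of_forall_lt fun t ht => ?_
  obtain ⟨r, hr1, hr2⟩ := ENNReal.lt_iff_exists_nnreal_btwn.1 ht
  refine hr1.trans_le (main r ?_ ?_)
  · have : (0 : ENNReal) < r := lt_of_le_of_lt bot_le hr1
    exact_mod_cast this
  · exact_mod_cast hr2
end
end

section
/- For every integer n ≥ 2 and every integer N ≥ 3, F_{β_n, N−1} ⊆ E_{β_n, N}; that is, if the greedy orbit of x ∈ [0, 1/(β_n−1)] never enters [0, β_n^{−(N−1)}/(β_n−1)], then no β_n-expansion of x contains a block of N consecutive zeros. -/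
open MeasureTheory Set Filter

noncomputable section

/-- The greedy β-transformation. -/
def greedyMap (β : ℝ) (x : ℝ) : ℝ := if x < 1 / β then β * x else β * x - 1

/-- `F_{β,N}`: points whose greedy orbit avoids `[0, β^{-N}/(β-1)]`. -/
def Fset (β : ℝ) (N : ℕ) : Set ℝ :=
  {x ∈ Icc 0 (1 / (β - 1)) |
    ∀ k : ℕ, (greedyMap β)^[k] x ∉ Icc 0 (β ^ (-(N : ℤ)) / (β - 1))}

/-- `a` contains a block of `N` consecutive zero digits. -/
def HasZeroBlock (a : ℕ → ℕ) (N : ℕ) : Prop := ∃ j : ℕ, ∀ i < N, a (j + i) = 0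

/-- `E_{β,N}`: points no β-expansion of which contains `N` consecutive zeros. -/
def Eset (β : ℝ) (N : ℕ) : Set ℝ :=
  {x ∈ Icc 0 (1 / (β - 1)) | ∀ a : ℕ → ℕ, IsBetaExpansion β x a → ¬ HasZeroBlock a N}

/-- Tail value of a digit sequence. -/
def tailVal (β : ℝ) (a : ℕ → ℕ) (k : ℕ) : ℝ := ∑' i, (a (k + i) : ℝ) / β ^ (i + 1)

/-- Possible gaps between an arbitrary orbit and the greedy orbit. -/
def gapVal (β : ℝ) (k : ℕ) : ℝ := β ^ k - ∑ i ∈ Finset.range k, β ^ i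

lemma geom_hasSum {β : ℝ} (h1 : 1 < β) :
    HasSum (fun i : ℕ => 1 / β ^ (i + 1)) (1 / (β - 1)) := by
  have h0 : 0 < β := by linarith
  have hb : β - 1 ≠ 0 := by linarith
  have := (hasSum_geometric_of_lt_one (inv_nonneg.2 h0.le) (inv_lt_one_of_one_lt₀ h1)).mul_left β⁻¹
  have e : β⁻¹ * (1 - β⁻¹)⁻¹ = 1 / (β - 1) := by
    have : 1 - β⁻¹ ≠ 0 := by
      have := inv_lt_one_of_one_lt₀ h1
      linarith
    field_simp
  rw [e] at this
  have e2 : (fun i : ℕ => 1 / β ^ (i + 1)) = fun i : ℕ => β⁻¹ * β⁻¹ ^ i := by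
    funext i
    rw [inv_pow, pow_succ, one_div, mul_inv, mul_comm]
  rw [e2]
  exact this

lemma tail_summable {β : ℝ} (h1 : 1 < β) {a : ℕ → ℕ} (ha : ∀ k, a k ≤ 1) (k : ℕ) :
    Summable (fun i => (a (k + i) : ℝ) / β ^ (i + 1)) := by
  have h0 : 0 < β := by linarith
  refine Summable.of_nonneg_of_le (fun i => by positivity) (fun i => ?_) (geom_hasSum h1).summable
  have : (a (k + i) : ℝ) ≤ 1 := by exact_mod_cast ha _
  gcongr

lemma tail_le {β : ℝ} (h1 : 1 < β) {a : ℕ → ℕ} (ha : ∀ k, a k ≤ 1) (k : ℕ) :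
    tailVal β a k ≤ 1 / (β - 1) := by
  have h0 : 0 < β := by linarith
  rw [← (geom_hasSum h1).tsum_eq]
  refine (tail_summable h1 ha k).tsum_le_tsum (fun i => ?_) (geom_hasSum h1).summable
  have : (a (k + i) : ℝ) ≤ 1 := by exact_mod_cast ha _
  gcongr

lemma tail_nonneg {β : ℝ} (h1 : 1 < β) (a : ℕ → ℕ) (k : ℕ) : 0 ≤ tailVal β a k := by
  have h0 : 0 < β := by linarith
  exact tsum_nonneg (fun i => by positivity)

lemma tail_succ {β : ℝ} (h1 : 1 < β) {a : ℕ → ℕ} (ha : ∀ k, a k ≤ 1) (k : ℕ) :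
    tailVal β a (k + 1) = β * tailVal β a k - a k := by
  have h0 : 0 < β := by linarith
  have h := (tail_summable h1 ha k).tsum_eq_zero_add
  have e : ∑' i, (a (k + (i + 1)) : ℝ) / β ^ (i + 1 + 1) = β⁻¹ * tailVal β a (k + 1) := by
    unfold tailVal
    rw [← tsum_mul_left]
    refine tsum_congr (fun i => ?_)
    rw [show k + (i + 1) = k + 1 + i by ring]
    field_simp
    ring
  rw [e] at h
  change tailVal β a k = _ at h
  rw [h]
  simp
  field_simp
  ring

lemma tail_zeros {β : ℝ} (h1 : 1 < β) {a : ℕ → ℕ} (ha : ∀ k, a k ≤ 1) (j N : ℕ)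
    (hz : ∀ i < N, a (j + i) = 0) : tailVal β a (j + N) = β ^ N * tailVal β a j := by
  induction N with
  | zero => simp
  | succ m ih =>
    rw [← add_assoc, tail_succ h1 ha, ih (fun i hi => hz i (by omega)), hz m (by omega)]
    push_cast
    ring

lemma gap_succ (β : ℝ) (k : ℕ) : gapVal β (k + 1) = β * gapVal β k - 1 := by
  unfold gapVal
  rw [Finset.sum_range_succ']
  simp only [pow_succ, ← Finset.sum_mul]
  ring

lemma gap_le_one {β : ℝ} (h1 : 1 < β) (h2 : β < 2) (k : ℕ) : gapVal β k ≤ 1 := by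
  induction k with
  | zero => simp [gapVal]
  | succ m ih => rw [gap_succ]; nlinarith

lemma gap_antitone {β : ℝ} (h1 : 1 < β) (h2 : β < 2) : Antitone (gapVal β) := by
  refine antitone_nat_of_succ_le (fun k => ?_)
  rw [gap_succ]
  nlinarith [gap_le_one h1 h2 k]

lemma gap_ge {n : ℕ} {β : ℝ} (hβ : IsNBonacci n β) {k : ℕ} (hk : k < n) :
    1 / β ≤ gapVal β k := by
  obtain ⟨⟨h1, h2⟩, h⟩ := hβ
  obtain ⟨m, rfl⟩ : ∃ m, n = m + 1 := ⟨n - 1, by omega⟩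
  have h0 : 0 < β := by linarith
  have e : gapVal β (m + 1) = 0 := by unfold gapVal; rw [h]; ring
  rw [gap_succ] at e
  have := gap_antitone h1 h2 (show k ≤ m by omega)
  rw [div_le_iff₀ h0]
  nlinarith

lemma nb_sq {n : ℕ} (hn : 2 ≤ n) {β : ℝ} (hβ : IsNBonacci n β) : β + 1 ≤ β ^ 2 := by
  obtain ⟨⟨h1, h2⟩, h⟩ := hβ
  obtain ⟨m, rfl⟩ : ∃ m, n = m + 2 := ⟨n - 2, by omega⟩
  have h0 : 0 < β := by linarith
  rw [Finset.sum_range_succ, Finset.sum_range_succ] at h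
  have : 0 ≤ ∑ i ∈ Finset.range m, β ^ i := Finset.sum_nonneg (fun i _ => by positivity)
  have hp : 0 < β ^ m := by positivity
  have : β ^ m * (β + 1) ≤ β ^ m * β ^ 2 := by
    have e1 : β ^ (m + 2) = β ^ m * β ^ 2 := by ring
    have e2 : β ^ (m + 1) = β ^ m * β := by ring
    rw [e1, e2] at h
    linarith
  exact le_of_mul_le_mul_left this hp

lemma gap_invariant {n : ℕ} (hn : 2 ≤ n) {β : ℝ} (hβ : IsNBonacci n β) {x : ℝ} {a : ℕ → ℕ}
    (ha : ∀ k, a k ≤ 1) (hx : tailVal β a 0 = x) (hg : ∀ k, 0 < (greedyMap β)^[k] x) (k : ℕ) :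
    tailVal β a k - (greedyMap β)^[k] x = 0 ∨
      ∃ l < n, tailVal β a k - (greedyMap β)^[k] x = gapVal β l := by
  have h1 : 1 < β := hβ.1.1
  have h2 : β < 2 := hβ.1.2
  have h0 : 0 < β := by linarith
  have hsq := nb_sq hn hβ
  have hbig : 1 / (β - 1) ≤ 1 + 1 / β := by
    have hb : 0 < β - 1 := by linarith
    rw [div_le_iff₀ hb]
    have : (1 + 1 / β) * (β - 1) = (β ^ 2 - 1) / β := by field_simp; ring
    rw [this, le_div_iff₀ h0]
    linarith
  induction k with
  | zero => left; simp [hx]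
  | succ k ih =>
    have hy := tail_succ h1 ha k
    have hyl := tail_le h1 ha (k + 1)
    have hy0 := tail_nonneg h1 a (k + 1)
    have hgp := hg (k + 1)
    have hak : (a k : ℝ) = 0 ∨ (a k : ℝ) = 1 := by
      have := ha k
      interval_cases a k <;> simp
    rw [Function.iterate_succ_apply'] at hgp ⊢
    generalize (greedyMap β)^[k] x = g at *
    generalize tailVal β a (k + 1) = y' at *
    generalize tailVal β a k = y at *
    have hgr : (greedyMap β g = β * g ∧ g < 1 / β) ∨ (greedyMap β g = β * g - 1) := by
      unfold greedyMap
      split_ifs with hc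
      · exact Or.inl ⟨rfl, hc⟩
      · exact Or.inr rfl
    generalize greedyMap β g = g' at *
    have hd : y' - g' < 1 + 1 / β := by linarith
    have hib : 1 / β < 1 := by rw [div_lt_one h0]; exact h1
    rcases ih with ih | ⟨l, hl, ih⟩
    · have : y = g := by linarith
      subst this
      rcases hgr with ⟨hgr, hc⟩ | hgr <;> rcases hak with hak | hak
      · left; rw [hy, hgr, hak]; ring
      · exfalso
        rw [lt_div_iff₀ h0] at hc
        rw [hak] at hy
        linarith
      · right; exact ⟨0, by omega, by rw [hy, hgr, hak]; simp [gapVal]⟩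
      · left; rw [hy, hgr, hak]; ring
    · have hs := gap_succ β l
      rw [← ih] at hs
      by_cases hln : l + 1 < n
      · have hge := gap_ge hβ hln
        right
        refine ⟨l + 1, hln, ?_⟩
        rcases hgr with ⟨hgr, hc⟩ | hgr <;> rcases hak with hak | hak <;> rw [hak] at hy <;>
          linarith
      · have hn' : l + 1 = n := by omega
        have e : gapVal β (l + 1) = 0 := by
          unfold gapVal; rw [hn', hβ.2]; ring
        have e0 : gapVal β 0 = 1 := by simp [gapVal]
        rcases hgr with ⟨hgr, hc⟩ | hgr <;> rcases hak with hak | hak <;> rw [hak] at hy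
        · right; exact ⟨0, by omega, by linarith⟩
        · left; linarith
        · exfalso; linarith
        · right; exact ⟨0, by omega, by linarith⟩

lemma greedy_mem {β : ℝ} (h1 : 1 < β) {x : ℝ} (hx : 0 ≤ x) (k : ℕ) :
    0 ≤ (greedyMap β)^[k] x := by
  have h0 : 0 < β := by linarith
  induction k with
  | zero => simpa
  | succ k ih =>
    rw [Function.iterate_succ_apply']
    unfold greedyMap
    split_ifs with hc
    · positivity
    · rw [not_lt, div_le_iff₀ h0] at hc
      linarith

/-- For integers `n ≥ 2` and `N ≥ 3`, `F_{β_n, N-1} ⊆ E_{β_n, N}`. -/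
theorem Fset_subset_Eset (n N : ℕ) (hn : 2 ≤ n) (hN : 3 ≤ N) (β : ℝ)
    (hβ : IsNBonacci n β) :
    Fset β (N - 1) ⊆ Eset β N := by
  intro x hx
  obtain ⟨hxI, hF⟩ := hx
  refine ⟨hxI, ?_⟩
  rintro a ⟨ha, hsum⟩ ⟨j, hz⟩
  have h1 : 1 < β := hβ.1.1
  have h0 : 0 < β := by linarith
  have hb : 0 < β - 1 := by linarith
  have hg : ∀ k, 0 < (greedyMap β)^[k] x := by
    intro k
    refine lt_of_le_of_ne (greedy_mem h1 hxI.1 k) (fun h => hF k ?_)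
    rw [← h]
    exact ⟨le_rfl, by positivity⟩
  have hx0 : tailVal β a 0 = x := by
    unfold tailVal
    simpa using hsum.tsum_eq
  have hle : (greedyMap β)^[j] x ≤ tailVal β a j := by
    rcases gap_invariant hn hβ ha hx0 hg j with h | ⟨l, hl, h⟩
    · linarith
    · have := gap_ge hβ hl
      have : 0 < 1 / β := by positivity
      linarith
  apply hF j
  refine ⟨(hg j).le, hle.trans ?_⟩
  have hzz := tail_zeros h1 ha j (N - 1) (fun i hi => hz i (by omega))
  have hl := tail_le h1 ha (j + (N - 1))
  rw [hzz] at hl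
  rw [zpow_neg, zpow_natCast]
  have hp : 0 < β ^ (N - 1) := by positivity
  rw [le_div_iff₀ hb] at hl ⊢
  rw [← one_div, le_div_iff₀ hp]
  linarith
end
end

section
/- For every real β with 1 < β < 2, the Hausdorff dimension of F_{β,N} tends to 1 as N → ∞. -/
open MeasureTheory Set Filter

noncomputable section

open scoped NNReal ENNReal Topology

lemma gm_eq {β : ℝ} (hb : 0 < β) (z : ℝ) :
    greedyMap β z = if β * z < 1 then β * z else β * z - 1 := by
  unfold greedyMap
  simp only [lt_div_iff₀' hb]

lemma gm_nonneg {β : ℝ} (hβ : 1 < β) {z : ℝ} (hz : 0 ≤ z) : 0 ≤ greedyMap β z := by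
  unfold greedyMap
  split_ifs with h
  · positivity
  · have : 1 / β * β = 1 := by field_simp
    nlinarith [not_lt.1 h]

lemma gm_le {β : ℝ} {z : ℝ} : greedyMap β z ≤ β * z := by
  unfold greedyMap
  split_ifs with h <;> linarith

lemma gm_iter_nonneg {β : ℝ} (hβ : 1 < β) {z : ℝ} (hz : 0 ≤ z) (k : ℕ) :
    0 ≤ (greedyMap β)^[k] z := by
  induction k with
  | zero => simpa
  | succ k ih => rw [Function.iterate_succ_apply']; exact gm_nonneg hβ ih

lemma gm_iter_le {β : ℝ} (hβ : 1 < β) {z : ℝ} (k : ℕ) :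
    (greedyMap β)^[k] z ≤ β ^ k * z := by
  induction k with
  | zero => simp
  | succ k ih =>
    rw [Function.iterate_succ_apply']
    refine gm_le.trans ?_
    rw [pow_succ']
    nlinarith

/-- quasi-greedy orbit of 1 -/
def tq (β : ℝ) : ℕ → ℝ
  | 0 => 1
  | n + 1 => if 1 < β * tq β n then β * tq β n - 1 else β * tq β n

lemma tq_mem {β : ℝ} (hβ : 1 < β) (hβ2 : β < 2) (n : ℕ) : 0 < tq β n ∧ tq β n ≤ 1 := by
  induction n with
  | zero => simp [tq]
  | succ n ih =>
    obtain ⟨h1, h2⟩ := ih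
    simp only [tq]
    split_ifs with h
    · constructor <;> nlinarith
    · constructor
      · positivity
      · linarith

lemma gm_iter_one_sub {β : ℝ} (hβ : 1 < β) (n : ℕ) :
    ∀ u : ℝ, 0 < u → u ≤ tq β n → (greedyMap β)^[n] (1 - β⁻¹ ^ n * u) = tq β n - u := by
  induction n with
  | zero => intro u _ _; simp [tq]
  | succ n ih =>
    intro u hu hun
    have hb : 0 < β := by linarith
    have hle : tq β (n+1) ≤ β * tq β n := by
      simp only [tq]; split_ifs <;> linarith
    have h1 : (1 - β⁻¹ ^ (n+1) * u) = 1 - β⁻¹ ^ n * (β⁻¹ * u) := by ring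
    have h2 : β * (β⁻¹ * u) = u := by field_simp
    have h3 : β⁻¹ * u ≤ tq β n := by
      have : β⁻¹ * u ≤ β⁻¹ * (β * tq β n) := by gcongr; linarith
      rwa [inv_mul_cancel_left₀ hb.ne'] at this
    rw [Function.iterate_succ_apply', h1, ih _ (by positivity) h3]
    rw [gm_eq hb]
    simp only [tq] at hun ⊢
    have h4 : β * (tq β n - β⁻¹ * u) = β * tq β n - u := by rw [mul_sub, h2]
    rw [h4]
    split_ifs at hun ⊢ <;> linarith

lemma gm_shift {β : ℝ} (hβ : 1 < β) (i : ℕ) (z : ℝ) (hz : 0 ≤ z) (hz1 : z < 1) :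
    (greedyMap β)^[i] (β⁻¹ ^ i * z) = z := by
  have hb : 0 < β := by linarith
  induction i with
  | zero => simp
  | succ i ih =>
    rw [Function.iterate_succ_apply]
    have h1 : β * (β⁻¹ ^ (i+1) * z) = β⁻¹ ^ i * z := by
      rw [pow_succ]; field_simp
    have h2 : β⁻¹ ^ i ≤ 1 := pow_le_one₀ (by positivity) (inv_le_one_of_one_le₀ hβ.le)
    have : greedyMap β (β⁻¹ ^ (i+1) * z) = β⁻¹ ^ i * z := by
      rw [gm_eq hb, h1, if_pos (by nlinarith)]
    rw [this, ih]

/-- left endpoints -/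
def cq (β : ℝ) (n : ℕ) : ℝ := 1 - β⁻¹ ^ n * tq β n

lemma cq_succ {β : ℝ} (hβ : 1 < β) (n : ℕ) :
    cq β (n+1) = cq β n + if 1 < β * tq β n then β⁻¹ ^ (n+1) else 0 := by
  have hb : 0 < β := by linarith
  have : β⁻¹ ^ (n+1) * (β * tq β n) = β⁻¹ ^ n * tq β n := by
    rw [pow_succ]; field_simp
  simp only [cq, tq]
  split_ifs
  · rw [mul_sub, this]; ring
  · rw [this]; ring

lemma cq_mono {β : ℝ} (hβ : 1 < β) : Monotone (cq β) := by
  refine monotone_nat_of_le_succ fun n => ?_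
  rw [cq_succ hβ]
  have hb : 0 < β := by linarith
  split_ifs
  · have : 0 < β⁻¹ ^ (n+1) := by positivity
    linarith
  · simp

lemma cq_one {β : ℝ} (hβ : 1 < β) : cq β 1 = β⁻¹ := by
  rw [cq_succ hβ]; simp [cq, tq, hβ]

lemma cq_lt {β : ℝ} (hβ : 1 < β) (hβ2 : β < 2) (n : ℕ) : cq β n < 1 := by
  have hb : 0 < β := by linarith
  have := (tq_mem hβ hβ2 n).1
  have : 0 < β⁻¹ ^ n * tq β n := by positivity
  unfold cq; linarith

lemma cq_tendsto {β : ℝ} (hβ : 1 < β) (hβ2 : β < 2) : Tendsto (cq β) atTop (𝓝 1) := by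
  have hb : 0 < β := by linarith
  have h : Tendsto (fun n : ℕ => β⁻¹ ^ n) atTop (𝓝 0) :=
    tendsto_pow_atTop_nhds_zero_of_lt_one (by positivity) (inv_lt_one_of_one_lt₀ hβ)
  have h2 : Tendsto (fun n : ℕ => β⁻¹ ^ n * tq β n) atTop (𝓝 0) := by
    refine squeeze_zero (fun n => ?_) (fun n => ?_) h
    · have := (tq_mem hβ hβ2 n).1; positivity
    · exact mul_le_of_le_one_right (by positivity) (tq_mem hβ hβ2 n).2
  have h3 := (tendsto_const_nhds (x := (1:ℝ))).sub h2
  rw [sub_zero] at h3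
  exact h3

lemma full_cyl {β : ℝ} (hβ : 1 < β) (hβ2 : β < 2) (i n : ℕ) (hn : 1 ≤ n) (ht : 1 < β * tq β n)
    (x : ℝ) (hx : 0 ≤ x) (hx1 : x < 1) :
    (greedyMap β)^[i + n + 1] (β⁻¹ ^ i * cq β n + β⁻¹ ^ (i + n + 1) * x) = x := by
  have hb : 0 < β := by linarith
  have e : β⁻¹ ^ i * cq β n + β⁻¹ ^ (i + n + 1) * x
      = β⁻¹ ^ i * (1 - β⁻¹ ^ n * (tq β n - β⁻¹ * x)) := by
    unfold cq; ring
  have e2 : (1 - β⁻¹ ^ n * (tq β n - β⁻¹ * x)) = cq β n + β⁻¹ ^ (n+1) * x := by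
    unfold cq; ring
  have h0 : 0 ≤ cq β n := by
    refine le_trans ?_ (cq_mono hβ hn)
    rw [cq_one hβ]; positivity
  have hs := cq_succ hβ n
  rw [if_pos ht] at hs
  have hl := cq_lt hβ hβ2 (n+1)
  have hp : 0 < β⁻¹ ^ (n+1) := by positivity
  have hux : β⁻¹ * x < tq β n := by
    rw [inv_mul_lt_iff₀ hb]; linarith
  have hux0 : 0 ≤ β⁻¹ * x := by positivity
  rw [e, show i + n + 1 = (1 + n) + i by ring, Function.iterate_add_apply,
    gm_shift hβ i _ (by rw [e2]; positivity) (by rw [e2]; nlinarith),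
    Function.iterate_add_apply, gm_iter_one_sub hβ n _ (by linarith) (by linarith)]
  simp only [Function.iterate_one, sub_sub_cancel]
  rw [gm_eq hb, mul_inv_cancel_left₀ hb.ne', if_pos hx1]

lemma exists_tiling {ι : Type*} [DecidableEq ι] (p : ι → ℝ) (s : Finset ι) :
    ∃ b : ι → ℝ, ∀ y : ℝ, 0 ≤ y → y < ∑ i ∈ s, p i → ∃ i ∈ s, b i ≤ y ∧ y < b i + p i := by
  induction s using Finset.induction_on with
  | empty => exact ⟨0, fun y h1 h2 => by simp at h2; linarith⟩
  | insert a s ha ih =>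
    obtain ⟨b, hb⟩ := ih
    refine ⟨Function.update b a (∑ i ∈ s, p i), fun y h1 h2 => ?_⟩
    rw [Finset.sum_insert ha] at h2
    by_cases h : y < ∑ i ∈ s, p i
    · obtain ⟨i, hi, hh⟩ := hb y h1 h
      have : i ≠ a := fun h => ha (h ▸ hi)
      exact ⟨i, Finset.mem_insert_of_mem hi, by simpa [Function.update_of_ne this] using hh⟩
    · exact ⟨a, Finset.mem_insert_self _ _, by simp; constructor <;> linarith⟩

lemma exists_coding (a r : ℝ → ℝ) (U : ℝ → ℝ) (S : Set ℝ) (hU : ∀ y ∈ S, U y ∈ S)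
    (ha : ∀ y ∈ S, 0 ≤ a y) (hr : ∀ y ∈ S, 0 ≤ r y) (har : ∀ y ∈ S, a y + r y ≤ 1) :
    ∃ h : ℝ → ℝ, ∀ y ∈ S, 0 ≤ h y ∧ h y ≤ 1 ∧ h y = a y + r y * h (U y) := by
  let H : ℕ → ℝ → ℝ := fun n => Nat.rec (fun _ => 0) (fun _ f y => a y + r y * f (U y)) n
  have Hs : ∀ n y, H (n+1) y = a y + r y * H n (U y) := fun _ _ => rfl
  have H0 : ∀ y, H 0 y = 0 := fun _ => rfl
  have hb : ∀ n, ∀ y ∈ S, 0 ≤ H n y ∧ H n y ≤ 1 := by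
    intro n
    induction n with
    | zero => intro y _; simp [H0]
    | succ n ih =>
      intro y hy
      rw [Hs]
      have h1 := ih _ (hU y hy)
      have h2 := ha y hy
      have h3 := hr y hy
      have h4 := har y hy
      constructor
      · have := mul_nonneg h3 h1.1
        linarith
      · nlinarith
  have hm : ∀ n, ∀ y ∈ S, H n y ≤ H (n+1) y := by
    intro n
    induction n with
    | zero => intro y hy; rw [H0]; exact (hb 1 y hy).1
    | succ n ih =>
      intro y hy
      rw [Hs, Hs (n+1)]
      have := mul_le_mul_of_nonneg_left (ih _ (hU y hy)) (hr y hy)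
      linarith
  have ht : ∀ y ∈ S, Tendsto (fun n => H n y) atTop (𝓝 (⨆ n, H n y)) := by
    intro y hy
    refine tendsto_atTop_ciSup (monotone_nat_of_le_succ fun n => hm n y hy) ⟨1, ?_⟩
    rintro _ ⟨n, rfl⟩
    exact (hb n y hy).2
  refine ⟨fun y => ⨆ n, H n y, fun y hy => ⟨?_, ?_, ?_⟩⟩
  · exact ge_of_tendsto' (ht y hy) fun n => (hb n y hy).1
  · exact le_of_tendsto' (ht y hy) fun n => (hb n y hy).2
  · have h1 := (ht y hy).comp (tendsto_add_atTop_nat 1)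
    have h2 := ((ht _ (hU y hy)).const_mul (r y)).const_add (a y)
    exact tendsto_nhds_unique h1 h2

lemma dim_of_expand (h : ℝ → ℝ) (C s : ℝ≥0) (hs : 0 < s)
    (hh : ∀ y ∈ Ico (0:ℝ) 1, ∀ y' ∈ Ico (0:ℝ) 1, |y - y'| ≤ C * |h y - h y'| ^ (s:ℝ)) :
    (s : ℝ≥0∞) ≤ dimH (h '' Ico 0 1) := by
  have hinj : InjOn h (Ico 0 1) := by
    intro y hy y' hy' he
    have := hh y hy y' hy'
    rw [he, sub_self, abs_zero, Real.zero_rpow (by exact_mod_cast hs.ne'), mul_zero] at this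
    exact sub_eq_zero.1 (abs_eq_zero.1 (le_antisymm this (abs_nonneg _)))
  have hl := hinj.leftInvOn_invFunOn
  have hold : HolderOnWith C s (Function.invFunOn h (Ico 0 1)) (h '' Ico 0 1) := by
    rintro _ ⟨y, hy, rfl⟩ _ ⟨y', hy', rfl⟩
    rw [hl hy, hl hy', edist_dist, edist_dist, Real.dist_eq, Real.dist_eq,
      ENNReal.ofReal_rpow_of_nonneg (abs_nonneg _) s.coe_nonneg, ← ENNReal.ofReal_coe_nnreal,
      ← ENNReal.ofReal_mul C.coe_nonneg]
    exact ENNReal.ofReal_le_ofReal (hh y hy y' hy')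
  have h1 := hold.dimH_image_le hs
  rw [hl.image_image] at h1
  have h2 : dimH (Ico (0:ℝ) 1) = 1 := by
    rw [Real.dimH_of_nonempty_interior (by simp)]
    simp
  rw [h2, ENNReal.le_div_iff_mul_le (by left; exact_mod_cast hs.ne') (by simp)] at h1
  simpa using h1

lemma key {β : ℝ} (hβ : 1 < β) {ι : Type} [Fintype ι] [DecidableEq ι] (a : ι → ℝ) (ℓ : ι → ℕ)
    (s : ℝ≥0) (hs : 0 < s) (hℓ : ∀ i, 1 ≤ ℓ i) (ha : ∀ i, 0 < a i)
    (har : ∀ i, a i + β⁻¹ ^ ℓ i < 1)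
    (hdisj : ∀ i j, i ≠ j → a i + β⁻¹ ^ ℓ i ≤ a j ∨ a j + β⁻¹ ^ ℓ j ≤ a i)
    (hfull : ∀ i x, 0 ≤ x → x < 1 → (greedyMap β)^[ℓ i] (a i + β⁻¹ ^ ℓ i * x) = x)
    (hsum : 1 ≤ ∑ i, (β⁻¹ ^ ℓ i) ^ (s : ℝ)) :
    ∃ δ > 0, ∃ E : Set ℝ, (s : ℝ≥0∞) ≤ dimH E ∧
      ∀ x ∈ E, 0 ≤ x ∧ x ≤ 1 ∧ ∀ k, δ ≤ (greedyMap β)^[k] x := by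
  have hb : 0 < β := by linarith
  have hb1 : β⁻¹ < 1 := inv_lt_one_of_one_lt₀ hβ
  have hs' : (0:ℝ) < s := by exact_mod_cast hs
  have hne : Nonempty ι := by
    by_contra hcon
    rw [not_nonempty_iff] at hcon
    simp at hsum
    linarith
  set r : ι → ℝ := fun i => β⁻¹ ^ ℓ i with hr
  have hrpos : ∀ i, 0 < r i := fun i => by simp only [hr]; positivity
  have hrle : ∀ i, r i ≤ β⁻¹ := fun i =>
    pow_le_of_le_one (by positivity) hb1.le (by have := hℓ i; omega)
  set T := ∑ i, (r i) ^ (s : ℝ) with hT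
  have hTpos : 0 < T := by linarith
  set p : ι → ℝ := fun i => (r i) ^ (s : ℝ) / T with hp
  have hppos : ∀ i, 0 < p i := fun i => div_pos (Real.rpow_pos_of_pos (hrpos i) _) hTpos
  have hple : ∀ i, p i ≤ (r i) ^ (s : ℝ) := fun i =>
    div_le_self (Real.rpow_nonneg (hrpos i).le _) hsum
  set P : ℝ := β⁻¹ ^ (s : ℝ) with hP
  have hPpos : 0 < P := Real.rpow_pos_of_pos (by positivity) _
  have hP1 : P < 1 := Real.rpow_lt_one (by positivity) hb1 hs'
  have hpP : ∀ i, p i ≤ P := fun i =>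
    (hple i).trans (Real.rpow_le_rpow (hrpos i).le (hrle i) hs'.le)
  have hpsum : ∑ i, p i = 1 := by
    simp only [hp]; rw [← Finset.sum_div, div_self hTpos.ne']
  obtain ⟨b, hbt⟩ := exists_tiling p Finset.univ
  rw [hpsum] at hbt
  have hbt' : ∀ y : ℝ, ∃ i, y ∈ Ico (0:ℝ) 1 → b i ≤ y ∧ y < b i + p i := by
    intro y
    by_cases hy : y ∈ Ico (0:ℝ) 1
    · obtain ⟨i, -, hi⟩ := hbt y hy.1 hy.2
      exact ⟨i, fun _ => hi⟩
    · exact ⟨hne.some, fun h => absurd h hy⟩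
  choose c hc using hbt'
  set U : ℝ → ℝ := fun y => (y - b (c y)) / p (c y) with hUdef
  have hU : ∀ y ∈ Ico (0:ℝ) 1, U y ∈ Ico (0:ℝ) 1 := by
    intro y hy
    have h1 := hc y hy
    have h2 := hppos (c y)
    refine ⟨div_nonneg (by linarith) h2.le, ?_⟩
    simp only [hUdef]
    rw [div_lt_one h2]; linarith
  obtain ⟨h, hh⟩ := exists_coding (fun y => a (c y)) (fun y => r (c y)) U (Ico 0 1) hU
    (fun y _ => (ha _).le) (fun y _ => (hrpos _).le) (fun y _ => (har _).le)
  -- minimum values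
  obtain ⟨i0, hi0⟩ := Finite.exists_min a
  obtain ⟨i1, hi1⟩ := Finite.exists_min r
  obtain ⟨i2, hi2⟩ := Finite.exists_max ℓ
  have hlow : ∀ y ∈ Ico (0:ℝ) 1, a i0 ≤ h y := by
    intro y hy
    rw [(hh y hy).2.2]
    have := mul_nonneg (hrpos (c y)).le (hh _ (hU y hy)).1
    have := hi0 (c y)
    linarith
  have hlt : ∀ y ∈ Ico (0:ℝ) 1, h y < 1 := by
    intro y hy
    rw [(hh y hy).2.2]
    have h1 := mul_le_mul_of_nonneg_left (hh _ (hU y hy)).2.1 (hrpos (c y)).le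
    have h2 : a (c y) + r (c y) < 1 := har (c y)
    linarith
  set g : ℝ := r i1 * a i0 with hg
  have hgpos : 0 < g := mul_pos (hrpos _) (ha _)
  have hgap' : ∀ y ∈ Ico (0:ℝ) 1, ∀ y' ∈ Ico (0:ℝ) 1, a (c y) + r (c y) ≤ a (c y') →
      g ≤ h y' - h y := by
    intro y hy y' hy' hle
    rw [(hh y hy).2.2, (hh y' hy').2.2]
    have h1 := mul_le_mul_of_nonneg_left (hh _ (hU y hy)).2.1 (hrpos (c y)).le
    have h2 := mul_le_mul_of_nonneg_left (hlow _ (hU y' hy')) (hrpos (c y')).le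
    have h3 := mul_le_mul_of_nonneg_right (hi1 (c y')) (ha i0).le
    linarith
  have hgap : ∀ y ∈ Ico (0:ℝ) 1, ∀ y' ∈ Ico (0:ℝ) 1, c y ≠ c y' → g ≤ |h y - h y'| := by
    intro y hy y' hy' hne
    rcases hdisj _ _ hne with h1 | h1
    · have := hgap' y hy y' hy' h1
      rw [abs_sub_comm]; exact this.trans (le_abs_self _)
    · have := hgap' y' hy' y hy h1
      exact this.trans (le_abs_self _)
  have hgs : 0 < g ^ (s:ℝ) := Real.rpow_pos_of_pos hgpos _
  set C : ℝ≥0 := ⟨(g ^ (s:ℝ))⁻¹, by positivity⟩ with hC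
  have hCv : (C : ℝ) = (g ^ (s:ℝ))⁻¹ := rfl
  have hC0 : (0:ℝ) ≤ C := C.2
  have hmain : ∀ n : ℕ, ∀ y ∈ Ico (0:ℝ) 1, ∀ y' ∈ Ico (0:ℝ) 1,
      |y - y'| ≤ C * |h y - h y'| ^ (s:ℝ) + P ^ n := by
    intro n
    induction n with
    | zero =>
      intro y hy y' hy'
      have h1 : |y - y'| ≤ 1 := by
        rw [abs_le]; constructor <;> linarith [hy.1, hy.2, hy'.1, hy'.2]
      have : 0 ≤ C * |h y - h y'| ^ (s:ℝ) := by positivity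
      simp only [pow_zero]
      linarith
    | succ n ih =>
      intro y hy y' hy'
      by_cases hcc : c y = c y'
      · have e1 : y - y' = p (c y) * (U y - U y') := by
          have := (hppos (c y')).ne'
          simp only [hUdef, hcc]
          field_simp
          ring
        have e2 : h y - h y' = r (c y) * (h (U y) - h (U y')) := by
          rw [(hh y hy).2.2, (hh y' hy').2.2, hcc]; ring
        have e3 := ih _ (hU y hy) _ (hU y' hy')
        rw [e1, e2, abs_mul, abs_mul, abs_of_pos (hppos _), abs_of_pos (hrpos _),
          Real.mul_rpow (hrpos _).le (abs_nonneg _), pow_succ']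
        set X := |h (U y) - h (U y')| ^ (s:ℝ) with hX
        have hX0 : 0 ≤ X := Real.rpow_nonneg (abs_nonneg _) _
        calc p (c y) * |U y - U y'| ≤ p (c y) * (C * X + P ^ n) :=
              mul_le_mul_of_nonneg_left e3 (hppos _).le
          _ = p (c y) * (C * X) + p (c y) * P ^ n := by ring
          _ ≤ r (c y) ^ (s:ℝ) * (C * X) + P * P ^ n :=
              add_le_add (mul_le_mul_of_nonneg_right (hple _) (by positivity))
                (mul_le_mul_of_nonneg_right (hpP _) (by positivity))
          _ = _ := by ring
      · have h1 : |y - y'| ≤ 1 := by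
          rw [abs_le]; constructor <;> linarith [hy.1, hy.2, hy'.1, hy'.2]
        have h2 := Real.rpow_le_rpow hgpos.le (hgap y hy y' hy' hcc) hs'.le
        have h3 : 1 ≤ C * |h y - h y'| ^ (s:ℝ) := by
          rw [hCv, inv_mul_eq_div, one_le_div hgs]; exact h2
        have : 0 ≤ P ^ (n+1) := by positivity
        linarith
  have hmain' : ∀ y ∈ Ico (0:ℝ) 1, ∀ y' ∈ Ico (0:ℝ) 1,
      |y - y'| ≤ C * |h y - h y'| ^ (s:ℝ) := by
    intro y hy y' hy'
    have ht : Tendsto (fun n : ℕ => C * |h y - h y'| ^ (s:ℝ) + P ^ n) atTop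
        (𝓝 (C * |h y - h y'| ^ (s:ℝ) + 0)) :=
      (tendsto_pow_atTop_nhds_zero_of_lt_one hPpos.le hP1).const_add _
    rw [add_zero] at ht
    exact ge_of_tendsto' ht fun n => hmain n y hy y' hy'
  have hiter : ∀ y ∈ Ico (0:ℝ) 1, (greedyMap β)^[ℓ (c y)] (h y) = h (U y) := by
    intro y hy
    rw [(hh y hy).2.2]
    exact hfull _ _ (hh _ (hU y hy)).1 (hlt _ (hU y hy))
  have horb : ∀ k : ℕ, ∀ y ∈ Ico (0:ℝ) 1, β⁻¹ ^ ℓ i2 * a i0 ≤ (greedyMap β)^[k] (h y) := by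
    intro k
    induction k using Nat.strong_induction_on with
    | _ k ih =>
      intro y hy
      rcases lt_or_ge k (ℓ (c y)) with hk | hk
      · have h1 := hiter y hy
        rw [← Nat.sub_add_cancel hk.le, Function.iterate_add_apply] at h1
        set z := (greedyMap β)^[k] (h y) with hz
        have hz0 : 0 ≤ z := gm_iter_nonneg hβ (hh y hy).1 k
        have h2 := gm_iter_le hβ (z := z) (ℓ (c y) - k)
        rw [h1] at h2
        have h3 := hlow _ (hU y hy)
        have h4 : β ^ (ℓ (c y) - k) ≤ β ^ ℓ i2 :=
          pow_le_pow_right₀ hβ.le ((Nat.sub_le _ _).trans (hi2 _))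
        have h5 : a i0 ≤ β ^ ℓ i2 * z :=
          (h3.trans h2).trans (mul_le_mul_of_nonneg_right h4 hz0)
        rw [inv_pow, inv_mul_le_iff₀ (by positivity)]
        exact h5
      · rw [← Nat.sub_add_cancel hk, Function.iterate_add_apply, hiter y hy]
        exact ih _ (by have := hℓ (c y); omega) _ (hU y hy)
  refine ⟨β⁻¹ ^ ℓ i2 * a i0, mul_pos (by positivity) (ha _), h '' Ico 0 1,
    dim_of_expand h C s hs hmain', ?_⟩
  rintro _ ⟨y, hy, rfl⟩
  exact ⟨(hh y hy).1, (hh y hy).2.1, fun k => horb k y hy⟩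

lemma sum_cq {β : ℝ} (hβ : 1 < β) (m : ℕ) :
    ∑ n ∈ Finset.range m with (1 ≤ n ∧ 1 < β * tq β n), β⁻¹ ^ (n + 1) = cq β (max m 1) - β⁻¹ := by
  induction m with
  | zero => simp [cq_one hβ]
  | succ m ih =>
    rw [Finset.sum_filter] at ih ⊢
    rw [Finset.sum_range_succ, ih]
    rcases Nat.eq_zero_or_pos m with rfl | hm
    · simp
    · rw [max_eq_left (show 1 ≤ m from hm), max_eq_left (by omega), cq_succ hβ]
      simp only [show 1 ≤ m from hm, true_and]
      ring

lemma exists_param {β : ℝ} (hβ : 1 < β) (hβ2 : β < 2) (θ : ℝ) (hθ : θ < 1) :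
    ∃ m : ℕ, θ ≤ (∑ i ∈ Finset.range m, β⁻¹ ^ i) *
      ∑ n ∈ Finset.range m with (1 ≤ n ∧ 1 < β * tq β n), β⁻¹ ^ (n + 1) := by
  have hb : 0 < β := by linarith
  have hb1 : β⁻¹ < 1 := inv_lt_one_of_one_lt₀ hβ
  have h1 := (hasSum_geometric_of_lt_one (by positivity) hb1).tendsto_sum_nat
  have h2 : Tendsto (fun m : ℕ => ∑ n ∈ Finset.range m with (1 ≤ n ∧ 1 < β * tq β n),
      β⁻¹ ^ (n + 1)) atTop (𝓝 (1 - β⁻¹)) := by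
    simp only [sum_cq hβ]
    refine Tendsto.sub_const ?_ _
    refine (cq_tendsto hβ hβ2).congr' ?_
    filter_upwards [eventually_ge_atTop 1] with m hm
    rw [max_eq_left hm]
  have h3 := h1.mul h2
  rw [inv_mul_cancel₀ (by linarith)] at h3
  obtain ⟨m, hm⟩ := (h3.eventually (lt_mem_nhds hθ)).exists
  exact ⟨m, hm.le⟩

lemma main_lower {β : ℝ} (hβ : 1 < β) (hβ2 : β < 2) (s : ℝ≥0) (hs : 0 < s) (hs1 : s < 1) :
    ∃ δ > 0, ∃ E : Set ℝ, (s : ℝ≥0∞) ≤ dimH E ∧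
      ∀ x ∈ E, 0 ≤ x ∧ x ≤ 1 ∧ ∀ k, δ ≤ (greedyMap β)^[k] x := by
  have hb : 0 < β := by linarith
  have hb1 : β⁻¹ < 1 := inv_lt_one_of_one_lt₀ hβ
  have hs1' : (s:ℝ) < 1 := by exact_mod_cast hs1
  have hs' : (0:ℝ) < s := by exact_mod_cast hs
  set θ : ℝ := β⁻¹ ^ (1 - (s:ℝ)) with hθ
  have hθ0 : 0 < θ := Real.rpow_pos_of_pos (by positivity) _
  have hθ1 : θ < 1 := Real.rpow_lt_one (by positivity) hb1 (by linarith)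
  obtain ⟨m, hm⟩ := exists_param hβ hβ2 θ hθ1
  set A := (Finset.range m).filter (fun n => 1 ≤ n ∧ 1 < β * tq β n) with hA
  set Q := (Finset.range m) ×ˢ A with hQ
  have hQm : ∀ q : Q, 1 ≤ q.1.2 ∧ 1 < β * tq β q.1.2 := by
    rintro ⟨⟨i, n⟩, h⟩
    simp only [hQ, hA, Finset.mem_product, Finset.mem_filter] at h
    exact h.2.2
  have hle : ∀ i : ℕ, β⁻¹ ^ i ≤ 1 := fun i => pow_le_one₀ (by positivity) hb1.le
  have hcge : ∀ n, 1 ≤ n → β⁻¹ ≤ cq β n := fun n hn => by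
    rw [← cq_one hβ]; exact cq_mono hβ hn
  have hend : ∀ q : Q, β⁻¹ ^ q.1.1 * cq β q.1.2 + β⁻¹ ^ (q.1.1 + q.1.2 + 1)
      = β⁻¹ ^ q.1.1 * cq β (q.1.2 + 1) := by
    intro q
    rw [cq_succ hβ, if_pos (hQm q).2]; ring
  have hlex : ∀ q q' : Q, q.1.1 < q'.1.1 →
      β⁻¹ ^ q'.1.1 * cq β (q'.1.2 + 1) ≤ β⁻¹ ^ q.1.1 * cq β q.1.2 := by
    intro q q' h
    calc β⁻¹ ^ q'.1.1 * cq β (q'.1.2 + 1) ≤ β⁻¹ ^ q'.1.1 * 1 :=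
          mul_le_mul_of_nonneg_left (cq_lt hβ hβ2 _).le (by positivity)
      _ ≤ β⁻¹ ^ (q.1.1 + 1) := by
          rw [mul_one]; exact pow_le_pow_of_le_one (by positivity) hb1.le h
      _ = β⁻¹ ^ q.1.1 * β⁻¹ := pow_succ _ _
      _ ≤ _ := mul_le_mul_of_nonneg_left (hcge _ (hQm q).1) (by positivity)
  have hlex2 : ∀ q q' : Q, q.1.1 = q'.1.1 → q.1.2 < q'.1.2 →
      β⁻¹ ^ q.1.1 * cq β (q.1.2 + 1) ≤ β⁻¹ ^ q'.1.1 * cq β q'.1.2 := by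
    intro q q' h h'
    rw [h]
    exact mul_le_mul_of_nonneg_left (cq_mono hβ h') (by positivity)
  refine key hβ (ι := Q) (fun q => β⁻¹ ^ q.1.1 * cq β q.1.2) (fun q => q.1.1 + q.1.2 + 1) s hs
    (fun q => by omega) (fun q => ?_) (fun q => ?_) (fun q q' hne => ?_)
    (fun q x hx hx1 => full_cyl hβ hβ2 _ _ (hQm q).1 (hQm q).2 x hx hx1) ?_
  · have := hcge _ (hQm q).1
    have h0 : 0 < β⁻¹ := by positivity
    exact mul_pos (by positivity) (by linarith)
  · rw [hend]
    have h1 := cq_lt hβ hβ2 (q.1.2 + 1)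
    have h2 := hle q.1.1
    have h3 : 0 < β⁻¹ ^ q.1.1 := by positivity
    nlinarith
  · simp only [hend]
    rcases lt_trichotomy q.1.1 q'.1.1 with h | h | h
    · right; exact hlex _ _ h
    · rcases lt_trichotomy q.1.2 q'.1.2 with h' | h' | h'
      · left; exact hlex2 _ _ h h'
      · exact absurd (Subtype.ext (Prod.ext h h')) hne
      · right; exact hlex2 _ _ h.symm h'
    · left; exact hlex _ _ h
  · rw [Finset.sum_coe_sort Q (fun q => (β⁻¹ ^ (q.1 + q.2 + 1)) ^ (s:ℝ))]
    have hterm : ∀ q ∈ Q, θ⁻¹ * (β⁻¹ ^ q.1 * β⁻¹ ^ (q.2 + 1)) ≤ (β⁻¹ ^ (q.1 + q.2 + 1)) ^ (s:ℝ) := by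
      intro q _
      have e : β⁻¹ ^ q.1 * β⁻¹ ^ (q.2 + 1) = β⁻¹ ^ (q.1 + q.2 + 1) := by ring
      rw [e, inv_mul_le_iff₀ hθ0]
      set R := β⁻¹ ^ (q.1 + q.2 + 1) with hR
      have hR0 : 0 < R := by positivity
      have hRle : R ≤ β⁻¹ := pow_le_of_le_one (by positivity) hb1.le (by omega)
      calc R = R ^ (1 - (s:ℝ)) * R ^ (s:ℝ) := by
            rw [← Real.rpow_add hR0, sub_add_cancel, Real.rpow_one]
        _ ≤ θ * R ^ (s:ℝ) := mul_le_mul_of_nonneg_right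
            (Real.rpow_le_rpow hR0.le hRle (by linarith)) (Real.rpow_nonneg hR0.le _)
    refine le_trans ?_ (Finset.sum_le_sum hterm)
    rw [← Finset.mul_sum, hQ, Finset.sum_product]
    simp only []
    rw [← Finset.sum_mul_sum]
    rw [le_inv_mul_iff₀ hθ0, mul_one]
    exact hm

/-- For every real `1 < β < 2`, `dim_H F_{β,N} → 1` as `N → ∞`. -/
theorem tendsto_dimH_Fset (β : ℝ) (hβ : β ∈ Ioo (1 : ℝ) 2) :
    Tendsto (fun N : ℕ => dimH (Fset β N)) atTop (nhds 1) := by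
  obtain ⟨h1, h2⟩ := hβ
  have hb : 0 < β := by linarith
  rw [tendsto_order]
  constructor
  · intro x hx
    obtain ⟨s, hxs, hs1⟩ := ENNReal.lt_iff_exists_nnreal_btwn.1 hx
    have hs0 : 0 < s := by exact_mod_cast (zero_le.trans_lt hxs : (0:ℝ≥0∞) < s)
    obtain ⟨δ, hδ, E, hE, hEF⟩ := main_lower h1 h2 s hs0 (by exact_mod_cast hs1)
    have ht : Tendsto (fun N : ℕ => β⁻¹ ^ N / (β - 1)) atTop (𝓝 (0 / (β - 1))) :=
      (tendsto_pow_atTop_nhds_zero_of_lt_one (by positivity)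
        (inv_lt_one_of_one_lt₀ h1)).div_const _
    rw [zero_div] at ht
    filter_upwards [ht.eventually (gt_mem_nhds hδ)] with N hN
    refine hxs.trans_le (hE.trans (dimH_mono fun z hz => ?_))
    obtain ⟨hz0, hz1, hzk⟩ := hEF z hz
    refine ⟨⟨hz0, hz1.trans ?_⟩, fun k hk => ?_⟩
    · rw [le_div_iff₀ (by linarith)]; linarith
    · have := hk.2
      rw [zpow_neg, zpow_natCast, ← inv_pow] at this
      linarith [hzk k]
  · intro x hx
    refine Eventually.of_forall fun N => lt_of_le_of_lt ?_ hx
    rw [← Real.dimH_univ]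
    exact dimH_mono (subset_univ _)
end
end

section
/- For every integer n ≥ 2, the Hausdorff dimension of F_{β_n,N} tends to 1 as N → ∞. -/
open MeasureTheory Set Filter

noncomputable section

/-- Value of a digit sequence in base `1/x`. -/
def bval (x : ℝ) (e : ℕ → ℝ) : ℝ := ∑' i, e i * x ^ (i + 1)

/-- Digit sequences without `n` consecutive ones. -/
def NoRun (n : ℕ) (e : ℕ → ℝ) : Prop :=
  (∀ i, e i = 0 ∨ e i = 1) ∧ ∀ k, ∃ j < n, e (k + j) = 0

lemma NoRun.shift {n : ℕ} {e : ℕ → ℝ} (h : NoRun n e) (m : ℕ) : NoRun n (fun i => e (m + i)) :=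
  ⟨fun i => h.1 _, fun k => by
    obtain ⟨j, hj, h0⟩ := h.2 (m + k)
    exact ⟨j, hj, by simpa [add_assoc] using h0⟩⟩

lemma NoRun.nonneg {n : ℕ} {e : ℕ → ℝ} (h : NoRun n e) (i : ℕ) : 0 ≤ e i := by
  rcases h.1 i with h | h <;> simp [h]

lemma NoRun.le_one {n : ℕ} {e : ℕ → ℝ} (h : NoRun n e) (i : ℕ) : e i ≤ 1 := by
  rcases h.1 i with h | h <;> simp [h]

lemma sum_pow_mono {n : ℕ} {x : ℝ} (hx0 : 0 < x)
    (hsum : ∑ i ∈ Finset.range n, x ^ (i + 1) = 1) {j : ℕ} (hj : j ≤ n) :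
    ∑ i ∈ Finset.range j, x ^ (i + 1) ≤ 1 := by
  rw [← hsum]
  apply Finset.sum_le_sum_of_subset_of_nonneg (Finset.range_mono hj)
  intros; positivity

lemma finsum_le_one {n : ℕ} {x : ℝ} (hx0 : 0 < x)
    (hsum : ∑ i ∈ Finset.range n, x ^ (i + 1) = 1) (K : ℕ) :
    ∀ e, NoRun n e → ∑ i ∈ Finset.range K, e i * x ^ (i + 1) ≤ 1 := by
  induction K using Nat.strong_induction_on with
  | _ K ih =>
    intro e he
    obtain ⟨j, hj, h0⟩ := he.2 0
    rw [zero_add] at h0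
    have hle : ∀ m, ∑ i ∈ Finset.range m, e i * x ^ (i + 1) ≤
        ∑ i ∈ Finset.range m, x ^ (i + 1) := fun m =>
      Finset.sum_le_sum fun i _ => mul_le_of_le_one_left (by positivity) (he.le_one i)
    by_cases hK : K ≤ j
    · exact (hle K).trans (sum_pow_mono hx0 hsum (by omega))
    · obtain ⟨m, rfl⟩ : ∃ m, K = (j + 1) + m := ⟨K - (j + 1), by omega⟩
      rw [Finset.sum_range_add, Finset.sum_range_succ, h0]
      have h1 := ih m (by omega) _ (he.shift (j + 1))
      have h2 : ∑ i ∈ Finset.range m, e (j + 1 + i) * x ^ (j + 1 + i + 1) =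
          x ^ (j + 1) * ∑ i ∈ Finset.range m, e (j + 1 + i) * x ^ (i + 1) := by
        rw [Finset.mul_sum]
        refine Finset.sum_congr rfl fun i _ => by ring
      have h3 := sum_pow_mono hx0 hsum (show j + 1 ≤ n by omega)
      rw [Finset.sum_range_succ] at h3
      have h4 := hle j
      have h5 : x ^ (j + 1) * ∑ i ∈ Finset.range m, e (j + 1 + i) * x ^ (i + 1) ≤ x ^ (j + 1) :=
        mul_le_of_le_one_right (by positivity) h1
      rw [h2]
      linarith

lemma bval_summable {n : ℕ} {x : ℝ} (hx0 : 0 < x) (hx1 : x < 1) {e : ℕ → ℝ} (he : NoRun n e) :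
    Summable fun i => e i * x ^ (i + 1) := by
  refine Summable.of_nonneg_of_le (fun i => mul_nonneg (he.nonneg i) (by positivity))
    (fun i => mul_le_of_le_one_left (by positivity) (he.le_one i)) ?_
  exact (summable_nat_add_iff 1).2 (summable_geometric_of_lt_one hx0.le hx1)

lemma bval_le_one {n : ℕ} {x : ℝ} (hx0 : 0 < x)
    (hsum : ∑ i ∈ Finset.range n, x ^ (i + 1) = 1) {e : ℕ → ℝ} (he : NoRun n e) :
    bval x e ≤ 1 :=
  Real.tsum_le_of_sum_range_le (fun i => mul_nonneg (he.nonneg i) (by positivity))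
    fun K => finsum_le_one hx0 hsum K e he

lemma bval_split {n : ℕ} {x : ℝ} (hx0 : 0 < x) (hx1 : x < 1) {e : ℕ → ℝ} (he : NoRun n e)
    (m : ℕ) : bval x e = ∑ i ∈ Finset.range m, e i * x ^ (i + 1)
      + x ^ m * bval x (fun i => e (m + i)) := by
  unfold bval
  rw [← (bval_summable hx0 hx1 he).sum_add_tsum_nat_add m, ← tsum_mul_left]
  congr 1
  refine tsum_congr fun i => ?_
  rw [add_comm i m]; ring

lemma bval_ge {n : ℕ} {x : ℝ} (hx0 : 0 < x) (hx1 : x < 1) {e : ℕ → ℝ} (he : NoRun n e)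
    {j : ℕ} (hj : e j = 1) : x ^ (j + 1) ≤ bval x e := by
  have := (bval_summable hx0 hx1 he).le_tsum j
    (fun i _ => mul_nonneg (he.nonneg i) (by positivity))
  rw [hj, one_mul] at this
  exact this

lemma bval_lt_one {n : ℕ} (hn : 2 ≤ n) {x : ℝ} (hx0 : 0 < x) (hx1 : x < 1)
    (hsum : ∑ i ∈ Finset.range n, x ^ (i + 1) = 1) {e : ℕ → ℝ} (he : NoRun n e) {j : ℕ}
    (h0 : e j = 0) (h1 : e (j + 1) = 0) (h2 : e (j + 2) = 0) : bval x e < 1 := by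
  have he' : NoRun n (Function.update e (j + 1) 1) := by
    refine ⟨fun i => ?_, fun k => ?_⟩
    · by_cases hi : i = j + 1
      · simp [hi]
      · simpa [hi] using he.1 i
    · by_cases hk : k = j + 1
      · exact ⟨1, by omega, by subst hk; simpa [Function.update_apply] using h2⟩
      · by_cases hk2 : k = j
        · exact ⟨0, by omega, by subst hk2; simpa [Function.update_apply] using h0⟩
        obtain ⟨i, hi, hi0⟩ := he.2 k
        by_cases hki : k + i = j + 1
        · refine ⟨i - 1, by omega, ?_⟩
          rw [show k + (i - 1) = j by omega]
          simpa [Function.update_apply] using h0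
        · exact ⟨i, hi, by simpa [Function.update_apply, hki] using hi0⟩
  refine lt_of_lt_of_le ?_ (bval_le_one hx0 hsum he')
  refine Summable.tsum_lt_tsum (i := j + 1) (fun i => ?_) ?_
    (bval_summable hx0 hx1 he) (bval_summable hx0 hx1 he')
  · refine mul_le_mul_of_nonneg_right ?_ (by positivity)
    by_cases hi : i = j + 1
    · simp [hi, h1]
    · simp [hi]
  · simp [h1]; positivity

/-- Greedy digits. -/
def gdig (β y : ℝ) (i : ℕ) : ℝ := if (greedyMap β)^[i] y < 1 / β then 0 else 1

lemma gmap_mem {β : ℝ} (h1 : 1 < β) (h2 : β < 2) {y : ℝ} (hy : y ∈ Ico (0 : ℝ) 1) :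
    greedyMap β y ∈ Ico (0 : ℝ) 1 := by
  obtain ⟨hy0, hy1⟩ := hy
  have hb : (0 : ℝ) < β := by linarith
  unfold greedyMap
  split_ifs with h
  · rw [lt_div_iff₀ hb] at h
    constructor
    · positivity
    · linarith
  · rw [not_lt, div_le_iff₀ hb] at h
    constructor
    · linarith
    · nlinarith

lemma giter_mem {β : ℝ} (h1 : 1 < β) (h2 : β < 2) {y : ℝ} (hy : y ∈ Ico (0 : ℝ) 1) (k : ℕ) :
    (greedyMap β)^[k] y ∈ Ico (0 : ℝ) 1 := by
  induction k with
  | zero => simpa using hy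
  | succ k ih => rw [Function.iterate_succ_apply']; exact gmap_mem h1 h2 ih

lemma gdig_expand {β : ℝ} (h1 : 1 < β) (y : ℝ) (m : ℕ) :
    y = ∑ i ∈ Finset.range m, gdig β y i * β⁻¹ ^ (i + 1) + β⁻¹ ^ m * (greedyMap β)^[m] y := by
  induction m with
  | zero => simp
  | succ m ih =>
    rw [Finset.sum_range_succ, Function.iterate_succ_apply']
    have hb : β ≠ 0 := by linarith
    have key : (greedyMap β)^[m] y =
        β⁻¹ * (gdig β y m + greedyMap β ((greedyMap β)^[m] y)) := by
      unfold gdig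
      rw [greedyMap]
      split_ifs <;> field_simp <;> ring
    calc y = _ := ih
      _ = _ := by
        rw [pow_succ]
        linear_combination β⁻¹ ^ m * key

lemma gdig_noRun {n : ℕ} {β : ℝ} (h1 : 1 < β) (h2 : β < 2)
    (hsum : ∑ i ∈ Finset.range n, β⁻¹ ^ (i + 1) = 1) {y : ℝ} (hy : y ∈ Ico (0 : ℝ) 1) :
    NoRun n (gdig β y) := by
  have hd : ∀ y i, gdig β y i = 0 ∨ gdig β y i = 1 := by
    intro y i; unfold gdig; split_ifs <;> simp
  refine ⟨hd y, fun k => ?_⟩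
  by_contra! hcon
  have hz := giter_mem h1 h2 hy k
  have hs : ∀ i, gdig β ((greedyMap β)^[k] y) i = gdig β y (k + i) := by
    intro i
    unfold gdig
    rw [← Function.iterate_add_apply, add_comm]
  have hexp := gdig_expand h1 ((greedyMap β)^[k] y) n
  rw [Finset.sum_congr rfl (g := fun i => β⁻¹ ^ (i + 1)) (fun i hi => by
    rw [hs, (hd y (k + i)).resolve_left (hcon i (Finset.mem_range.1 hi)), one_mul]), hsum] at hexp
  have := (giter_mem h1 h2 hz n).1
  have : 0 ≤ β⁻¹ ^ n * (greedyMap β)^[n] ((greedyMap β)^[k] y) := by positivity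
  linarith [hz.2]

lemma gdig_close {β : ℝ} (h1 : 1 < β) (h2 : β < 2) {y z : ℝ} (hy : y ∈ Ico (0 : ℝ) 1)
    (hz : z ∈ Ico (0 : ℝ) 1) {k : ℕ} (h : ∀ i < k, gdig β y i = gdig β z i) :
    |y - z| ≤ β⁻¹ ^ k := by
  have ey := gdig_expand h1 y k
  have ez := gdig_expand h1 z k
  rw [Finset.sum_congr rfl (fun i hi => by rw [h i (Finset.mem_range.1 hi)])] at ey
  have e : y - z = β⁻¹ ^ k * ((greedyMap β)^[k] y - (greedyMap β)^[k] z) := by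
    linear_combination ey - ez
  have hp : 0 < β⁻¹ ^ k := by positivity
  rw [e, abs_mul, abs_of_pos hp]
  refine mul_le_of_le_one_right hp.le ?_
  have a := giter_mem h1 h2 hy k
  have b := giter_mem h1 h2 hz k
  rw [abs_le]
  constructor <;> linarith [a.1, a.2, b.1, b.2]

/-- Insert `01000` after each block of length `M`. -/
def ins (M : ℕ) (d : ℕ → ℝ) (j : ℕ) : ℝ :=
  if j % (M + 5) < M then d (j / (M + 5) * M + j % (M + 5))
  else if j % (M + 5) = M + 1 then 1 else 0

lemma ins_apply (M : ℕ) (d : ℕ → ℝ) (q r : ℕ) (hr : r < M + 5) :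
    ins M d (q * (M + 5) + r) = if r < M then d (q * M + r) else if r = M + 1 then 1 else 0 := by
  have h1 : (q * (M + 5) + r) % (M + 5) = r := by
    rw [Nat.mul_add_mod_self_right, Nat.mod_eq_of_lt hr]
  have h2 : (q * (M + 5) + r) / (M + 5) = q := by
    rw [mul_comm, Nat.mul_add_div (by omega), Nat.div_eq_of_lt hr, add_zero]
  unfold ins
  rw [h1, h2]

lemma exists_qr (M k : ℕ) : ∃ q r, r < M + 5 ∧ k = q * (M + 5) + r :=
  ⟨k / (M + 5), k % (M + 5), Nat.mod_lt _ (by omega), by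
    rw [mul_comm]; exact (Nat.div_add_mod k (M + 5)).symm⟩

lemma ins_noRun {n : ℕ} (hn : 2 ≤ n) (M : ℕ) {d : ℕ → ℝ} (hd : NoRun n d) :
    NoRun n (ins M d) := by
  refine ⟨fun i => ?_, fun k => ?_⟩
  · unfold ins
    split_ifs
    · exact hd.1 _
    · simp
    · simp
  · obtain ⟨q, r, hr, rfl⟩ := exists_qr M k
    by_cases hrM : r < M
    · obtain ⟨j, hj, h0⟩ := hd.2 (q * M + r)
      by_cases hjM : r + j < M
      · refine ⟨j, hj, ?_⟩
        rw [add_assoc, ins_apply _ _ _ _ (by omega), if_pos hjM, ← add_assoc, h0]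
      · refine ⟨M - r, by omega, ?_⟩
        rw [add_assoc, ins_apply _ _ _ _ (by omega), if_neg (by omega), if_neg (by omega)]
    · by_cases hr1 : r = M + 1
      · refine ⟨1, by omega, ?_⟩
        rw [add_assoc, ins_apply _ _ _ _ (by omega), if_neg (by omega), if_neg (by omega)]
      · refine ⟨0, by omega, ?_⟩
        rw [add_zero, ins_apply _ _ _ _ (by omega), if_neg (by omega), if_neg (by omega)]

lemma ins_sep (M : ℕ) (d : ℕ → ℝ) (k : ℕ) : ∃ j ≤ 2 * M + 10,
    ins M d (k + j) = 1 ∧ ins M d (k + (j + 1)) = 0 ∧ ins M d (k + (j + 2)) = 0 ∧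
      ins M d (k + (j + 3)) = 0 := by
  obtain ⟨q, r, hr, rfl⟩ := exists_qr M k
  have e : ∀ i, q * (M + 5) + r + (M + 5 - r + M + 1 + i) = (q + 1) * (M + 5) + (M + 1 + i) := by
    intro i
    rw [add_mul]; omega
  refine ⟨M + 5 - r + M + 1, by omega, ?_, ?_, ?_, ?_⟩
  · have := e 0
    rw [add_zero, add_zero] at this
    rw [this, ins_apply _ _ _ _ (by omega), if_neg (by omega), if_pos rfl]
  all_goals rw [e, ins_apply _ _ _ _ (by omega), if_neg (by omega), if_neg (by omega)]

lemma giter_bval {n : ℕ} {β : ℝ} (h1 : 1 < β) {e : ℕ → ℝ} (he : NoRun n e)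
    (hlt : ∀ k, bval β⁻¹ (fun i => e (k + i)) < 1) (k : ℕ) :
    (greedyMap β)^[k] (bval β⁻¹ e) = bval β⁻¹ (fun i => e (k + i)) := by
  have hx0 : 0 < β⁻¹ := by positivity
  have hx1 : β⁻¹ < 1 := inv_lt_one_of_one_lt₀ h1
  have hb : β ≠ 0 := by linarith
  induction k with
  | zero => simp
  | succ k ih =>
    rw [Function.iterate_succ_apply', ih]
    have hs := bval_split hx0 hx1 (he.shift k) 1
    have hss : (fun i => e (k + (1 + i))) = fun i => e (k + 1 + i) := by
      funext i; rw [add_assoc]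
    simp only [Finset.sum_range_one, add_zero, zero_add, pow_one] at hs
    rw [hss] at hs
    have hl := hlt (k + 1)
    have hnn : 0 ≤ bval β⁻¹ (fun i => e (k + 1 + i)) :=
      tsum_nonneg fun i => mul_nonneg (he.nonneg _) (by positivity)
    rw [hs]
    generalize bval β⁻¹ (fun i => e (k + 1 + i)) = v at *
    unfold greedyMap
    rcases he.1 k with h | h
    · rw [h, if_pos]
      · field_simp; ring
      · rw [one_div]; nlinarith
    · rw [h, if_neg]
      · field_simp; ring
      · rw [one_div]; nlinarith

lemma ins_first {n : ℕ} {x : ℝ} (hx0 : 0 < x) (hx1 : x < 1)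
    (hsum : ∑ i ∈ Finset.range n, x ^ (i + 1) = 1) {e e' : ℕ → ℝ} (he : NoRun n e)
    (he' : NoRun n e') {p : ℕ} (hlt : ∀ i < p, e i = e' i) (h1 : e p = 1) (h0 : e' p = 0)
    {c : ℝ} (hc : c ≤ bval x (fun i => e (p + 1 + i))) :
    x ^ (p + 1) * c ≤ bval x e - bval x e' := by
  have s := bval_split hx0 hx1 he (p + 1)
  have s' := bval_split hx0 hx1 he' (p + 1)
  rw [Finset.sum_range_succ, h1] at s
  rw [Finset.sum_range_succ, h0] at s'
  rw [Finset.sum_congr rfl (fun i hi => by rw [hlt i (Finset.mem_range.1 hi)])] at s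
  have hv := bval_le_one hx0 hsum (he'.shift (p + 1))
  have hp : 0 < x ^ (p + 1) := by positivity
  have : bval x e - bval x e' = x ^ (p + 1) * (1 + bval x (fun i => e (p + 1 + i))
      - bval x (fun i => e' (p + 1 + i))) := by
    linear_combination s - s'
  rw [this]
  exact mul_le_mul_of_nonneg_left (by linarith) hp.le

lemma ins_agree {M : ℕ} {d d' : ℕ → ℝ} {k : ℕ} (h : ∀ i < k, d i = d' i) (hM : 0 < M) :
    ∀ i < k / M * (M + 5) + k % M, ins M d i = ins M d' i := by
  intro i hi
  obtain ⟨q, r, hr, rfl⟩ := exists_qr M i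
  rw [ins_apply _ _ _ _ hr, ins_apply _ _ _ _ hr]
  split_ifs with hrM
  · apply h
    have hk := Nat.div_add_mod k M
    have hkm := Nat.mod_lt k hM
    have hq : q ≤ k / M := by
      by_contra! hq
      have : (k / M + 1) * (M + 5) ≤ q * (M + 5) := Nat.mul_le_mul_right _ hq
      rw [add_mul] at this
      omega
    rcases hq.eq_or_lt with hq | hq
    · subst hq
      rw [mul_comm] at hk
      omega
    · have : (q + 1) * M ≤ k / M * M := Nat.mul_le_mul_right _ hq
      rw [add_mul] at this
      rw [mul_comm] at hk
      omega
  all_goals rfl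

lemma main_lower_s3 (n : ℕ) (hn : 2 ≤ n) (β : ℝ) (h1 : 1 < β) (h2 : β < 2)
    (hsum : ∑ i ∈ Finset.range n, β⁻¹ ^ (i + 1) = 1) (M : ℕ) (hM : 0 < M) :
    ∀ᶠ N : ℕ in atTop, ENNReal.ofReal ((M : ℝ) / (M + 5)) ≤ dimH (Fset β N) := by
  have hx0 : 0 < β⁻¹ := by positivity
  have hx1 : β⁻¹ < 1 := inv_lt_one_of_one_lt₀ h1
  set x := β⁻¹ with hx
  set c : ℝ := x ^ (2 * M + 11) with hc
  have hc0 : 0 < c := by positivity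
  set g : ℝ → ℝ := fun y => bval x (ins M (gdig β y)) with hg
  have hE : ∀ y ∈ Ico (0 : ℝ) 1, NoRun n (ins M (gdig β y)) := fun y hy =>
    ins_noRun hn M (gdig_noRun h1 h2 hsum hy)
  have hlt : ∀ y ∈ Ico (0 : ℝ) 1, ∀ k, bval x (fun i => ins M (gdig β y) (k + i)) < 1 := by
    intro y hy k
    obtain ⟨j, _, _, a, b, d⟩ := ins_sep M (gdig β y) k
    exact bval_lt_one hn hx0 hx1 hsum ((hE y hy).shift k) (j := j + 1) a b d
  have hge : ∀ y ∈ Ico (0 : ℝ) 1, ∀ k, c ≤ bval x (fun i => ins M (gdig β y) (k + i)) := by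
    intro y hy k
    obtain ⟨j, hj, a, _⟩ := ins_sep M (gdig β y) k
    refine le_trans ?_ (bval_ge hx0 hx1 ((hE y hy).shift k) (j := j) a)
    exact pow_le_pow_of_le_one hx0.le hx1.le (by omega)
  have hdist : ∀ y ∈ Ico (0 : ℝ) 1, ∀ z ∈ Ico (0 : ℝ) 1, y ≠ z →
      ∃ k : ℕ, |y - z| ≤ x ^ k ∧ x ^ (k / M * (M + 5) + k % M + 1) * c ≤ |g y - g z| := by
    intro y hy z hz hne
    have hex : ∃ k, gdig β y k ≠ gdig β z k := by
      by_contra! hall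
      have hle : ∀ k, |y - z| ≤ x ^ k := fun k => gdig_close h1 h2 hy hz fun i _ => hall i
      have := ge_of_tendsto' (tendsto_pow_atTop_nhds_zero_of_lt_one hx0.le hx1) hle
      exact hne (sub_eq_zero.1 (abs_nonpos_iff.1 this))
    classical
    set k := Nat.find hex with hk
    have hkne := Nat.find_spec hex
    have hkag : ∀ i < k, gdig β y i = gdig β z i := fun i hi => by
      have := Nat.find_min hex hi
      simpa using this
    refine ⟨k, gdig_close h1 h2 hy hz hkag, ?_⟩
    have hag := ins_agree hkag hM
    have hat : ∀ d : ℕ → ℝ, ins M d (k / M * (M + 5) + k % M) = d k := by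
      intro d
      have := Nat.mod_lt k hM
      rw [ins_apply _ _ _ _ (by omega), if_pos this, mul_comm, Nat.div_add_mod]
    rcases (gdig_noRun h1 h2 hsum hy).1 k with a | a <;>
    rcases (gdig_noRun h1 h2 hsum hz).1 k with b | b
    · exact absurd (a.trans b.symm) hkne
    · rw [abs_sub_comm]
      refine (ins_first hx0 hx1 hsum (hE z hz) (hE y hy) (fun i hi => (hag i hi).symm)
        ((hat _).trans b) ((hat _).trans a) (hge z hz _)).trans (le_abs_self _)
    · exact (ins_first hx0 hx1 hsum (hE y hy) (hE z hz) hag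
        ((hat _).trans a) ((hat _).trans b) (hge y hy _)).trans (le_abs_self _)
    · exact absurd (a.trans b.symm) hkne
  set r : ℝ := (M : ℝ) / (M + 5) with hr
  have hMR : (0 : ℝ) < M := by exact_mod_cast hM
  have hr0 : 0 < r := by positivity
  set C : ℝ := ((x * c) ^ r)⁻¹ with hC
  have hC0 : 0 < C := by positivity
  have hhol : ∀ y ∈ Ico (0 : ℝ) 1, ∀ z ∈ Ico (0 : ℝ) 1, |y - z| ≤ C * |g y - g z| ^ r := by
    intro y hy z hz
    by_cases hne : y = z
    · subst hne
      simp only [sub_self, abs_zero]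
      positivity
    obtain ⟨k, ha, hb⟩ := hdist y hy z hz hne
    set p := k / M * (M + 5) + k % M with hp
    have hpr : (p : ℝ) * r ≤ k := by
      rw [hr, ← mul_div_assoc, div_le_iff₀ (by positivity)]
      have hk := Nat.div_add_mod k M
      have : p * M ≤ k * (M + 5) := by
        calc p * M = (k / M * M) * (M + 5) + k % M * M := by rw [hp]; ring
          _ ≤ (k / M * M) * (M + 5) + k % M * (M + 5) := by gcongr; omega
          _ = (M * (k / M) + k % M) * (M + 5) := by ring
          _ = k * (M + 5) := by rw [hk]
      exact_mod_cast this
    have e1 : (x ^ (p + 1) * c) ^ r ≤ |g y - g z| ^ r :=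
      Real.rpow_le_rpow (by positivity) hb hr0.le
    have e2 : (x ^ (p + 1) * c) ^ r = (x ^ p) ^ r * (x * c) ^ r := by
      rw [← Real.mul_rpow (by positivity) (by positivity)]
      congr 1; ring
    have e3 : x ^ k ≤ (x ^ p) ^ r := by
      rw [← Real.rpow_natCast x p, ← Real.rpow_mul hx0.le, ← Real.rpow_natCast x k]
      exact Real.rpow_le_rpow_of_exponent_ge hx0 hx1.le hpr
    rw [e2] at e1
    have hxc : 0 < (x * c) ^ r := by positivity
    calc |y - z| ≤ (x ^ p) ^ r := ha.trans e3
      _ = C * ((x ^ p) ^ r * (x * c) ^ r) := by rw [hC]; field_simp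
      _ ≤ _ := by gcongr
  have hinj : InjOn g (Ico 0 1) := by
    intro y hy z hz hyz
    have := hhol y hy z hz
    rw [hyz, sub_self, abs_zero, Real.zero_rpow hr0.ne', mul_zero] at this
    exact sub_eq_zero.1 (abs_nonpos_iff.1 this)
  have hHolder : HolderOnWith C.toNNReal r.toNNReal (Function.invFunOn g (Ico 0 1))
      (g '' Ico 0 1) := by
    rintro _ ⟨y, hy, rfl⟩ _ ⟨z, hz, rfl⟩
    rw [hinj.leftInvOn_invFunOn hy, hinj.leftInvOn_invFunOn hz, edist_dist, edist_dist,
      Real.dist_eq, Real.dist_eq]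
    rw [Real.coe_toNNReal r hr0.le, ENNReal.ofReal_rpow_of_nonneg (abs_nonneg _) hr0.le]
    change _ ≤ ENNReal.ofReal C * _
    rw [← ENNReal.ofReal_mul hC0.le]
    exact ENNReal.ofReal_le_ofReal (hhol y hy z hz)
  have hdim := hHolder.dimH_image_le (Real.toNNReal_pos.2 hr0)
  rw [hinj.leftInvOn_invFunOn.image_image] at hdim
  have hone : dimH (Ico (0 : ℝ) 1) = 1 := by
    have := Real.dimH_of_nonempty_interior (E := ℝ) (s := Ico (0 : ℝ) 1)
      (by rw [interior_Ico]; exact ⟨1 / 2, by norm_num, by norm_num⟩)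
    simpa using this
  rw [hone] at hdim
  change 1 ≤ _ / ENNReal.ofReal r at hdim
  have hr0' : ENNReal.ofReal r ≠ 0 := by simpa using hr0
  rw [ENNReal.le_div_iff_mul_le (Or.inl hr0') (Or.inl ENNReal.ofReal_ne_top), one_mul] at hdim
  have hsmall : ∀ᶠ N : ℕ in atTop, x ^ N / (β - 1) < c := by
    have : Tendsto (fun N : ℕ => x ^ N / (β - 1)) atTop (nhds (0 / (β - 1))) :=
      (tendsto_pow_atTop_nhds_zero_of_lt_one hx0.le hx1).div_const _
    rw [zero_div] at this
    exact this.eventually_lt_const hc0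
  filter_upwards [hsmall] with N hN
  refine hdim.trans (dimH_mono ?_)
  rintro _ ⟨y, hy, rfl⟩
  have hit := giter_bval h1 (hE y hy) (hlt y hy)
  refine ⟨⟨?_, ?_⟩, fun k hk => ?_⟩
  · have := hge y hy 0
    simp only [zero_add] at this
    exact hc0.le.trans this
  · have := hlt y hy 0
    simp only [zero_add] at this
    refine this.le.trans ?_
    rw [le_div_iff₀ (by linarith)]
    linarith
  · have h3 := hge y hy k
    have h4 := hk.2
    rw [hit k, zpow_neg, zpow_natCast, ← inv_pow] at h4
    linarith

/-- For every integer `n ≥ 2`, `dim_H F_{β_n,N} → 1` as `N → ∞`. -/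
theorem tendsto_dimH_Fset_nbonacci (n : ℕ) (hn : 2 ≤ n) (β : ℝ) (hβ : IsNBonacci n β) :
    Tendsto (fun N : ℕ => dimH (Fset β N)) atTop (nhds 1) := by
  obtain ⟨⟨h1, h2⟩, hs⟩ := hβ
  have hb : β ≠ 0 := by linarith
  have hsum : ∑ i ∈ Finset.range n, β⁻¹ ^ (i + 1) = 1 := by
    rw [← Finset.sum_range_reflect]
    have : ∀ i ∈ Finset.range n, β⁻¹ ^ (n - 1 - i + 1) = β ^ i * (β ^ n)⁻¹ := by
      intro i hi
      have hi' := Finset.mem_range.1 hi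
      obtain ⟨m, rfl⟩ : ∃ m, n = i + m + 1 := ⟨n - i - 1, by omega⟩
      rw [show i + m + 1 - 1 - i + 1 = m + 1 by omega, inv_pow]
      field_simp
      ring
    rw [Finset.sum_congr rfl this, ← Finset.sum_mul, ← hs]
    exact mul_inv_cancel₀ (pow_ne_zero _ hb)
  rw [tendsto_order]
  constructor
  · intro a ha
    have hlim : Tendsto (fun M : ℕ => ENNReal.ofReal ((M : ℝ) / (M + 5))) atTop (nhds 1) := by
      have := ENNReal.tendsto_ofReal (tendsto_natCast_div_add_atTop (𝕜 := ℝ) 5)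
      simpa using this
    obtain ⟨M, hM, hM0⟩ := ((hlim.eventually_const_lt ha).and (eventually_gt_atTop 0)).exists
    filter_upwards [main_lower_s3 n hn β h1 h2 hsum M hM0] with N hN
    exact hM.trans_le hN
  · intro a ha
    refine Eventually.of_forall fun N => lt_of_le_of_lt ?_ ha
    exact (dimH_mono (subset_univ _)).trans_eq Real.dimH_univ
end
end
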